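/- arXiv:2310.00931 — 2 statements merged into one kernel-verified Lean document; each statement's English description precedes it below -/
import Mathlib

section
/- Let k and d be positive integers and let ℓ = ⌊(d-1)/(k+1)⌋. Every finite simple graph G with maximum average degree mad(G) ≤ 2(k + d/(d+k+1)) admits a partition of its edge set into k+1 parts, each of which spans a pseudoforest, such that one of the parts F satisfies: (i) F is acyclic; (ii) every connected component K of F has at most d edges; (iii) every connected component K of F has diameter at most 2ℓ+2, and moreover diameter at most 2ℓ+1 if d ≡ 1 (mod k+1); and (iv) for every natural number z, every connected component K of F with at least d - z(k-1) + 1 edges has diameter at most 2z. -/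
open SimpleGraph

/-- The set of edges of the connected component `c` of the graph `H`. -/
def compEdges {V : Type*} (H : SimpleGraph V) (c : H.ConnectedComponent) : Set (Sym2 V) :=
  {e | e ∈ H.edgeSet ∧ ∀ v ∈ e, v ∈ c.supp}

/-- A graph is a pseudoforest if every connected component has at most as many
edges as vertices (equivalently, every component contains at most one cycle). -/
def IsPseudoforest {V : Type*} (H : SimpleGraph V) : Prop :=
  ∀ c : H.ConnectedComponent, (compEdges H c).ncard ≤ c.supp.ncard

/-- `P` is a partition of the edge set of `G` into `m` parts,
each of which spans a pseudoforest. -/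
def IsPseudoforestDecomp {V : Type*} (G : SimpleGraph V) (m : ℕ)
    (P : Fin m → Set (Sym2 V)) : Prop :=
  (∀ i, P i ⊆ G.edgeSet) ∧ (∀ i j, i ≠ j → Disjoint (P i) (P j)) ∧
    (⋃ i, P i) = G.edgeSet ∧ ∀ i, IsPseudoforest (SimpleGraph.fromEdgeSet (P i))

/-- The connected component `c` of `H` has diameter at most `b`. -/
def compDiamLE {V : Type*} (H : SimpleGraph V) (c : H.ConnectedComponent) (b : ℕ) : Prop :=
  ∀ u ∈ c.supp, ∀ v ∈ c.supp, H.dist u v ≤ b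

set_option linter.unusedSectionVars false

namespace NDT

open Classical Finset

variable {V : Type} [Fintype V]

/-- The vertex set of the component of `w`. -/
noncomputable def comp (F : SimpleGraph V) (w : V) : Finset V := univ.filter (fun u => F.Reachable w u)

/-- The number of vertices of the component of `w`. -/
noncomputable def nn (F : SimpleGraph V) (w : V) : ℕ := (comp F w).card

/-- The component of `w` violates the size / diameter condition. -/
def Bad (κ d : ℕ) (F : SimpleGraph V) (w : V) : Prop :=
  ∃ z a b, F.Reachable w a ∧ F.Reachable w b ∧ 2 * z + 1 ≤ F.dist a b ∧ d + 2 ≤ nn F w + z * κ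

/-- Add an edge. -/
def lk (D : SimpleGraph V) (x y : V) : SimpleGraph V := D ⊔ SimpleGraph.edge x y

/-- Delete an edge. -/
def ct (F : SimpleGraph V) (x z : V) : SimpleGraph V := F.deleteEdges {s(x, z)}

lemma mem_comp {F : SimpleGraph V} {w u : V} : u ∈ comp F w ↔ F.Reachable w u := by
  simp [comp]

lemma comp_eq {F : SimpleGraph V} {w u : V} (h : F.Reachable w u) : comp F w = comp F u := by
  ext a; simp only [mem_comp]; exact ⟨fun h1 => h.symm.trans h1, fun h1 => h.trans h1⟩

lemma nn_eq {F : SimpleGraph V} {w u : V} (h : F.Reachable w u) : nn F w = nn F u := by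
  simp [nn, comp_eq h]

lemma nn_pos (F : SimpleGraph V) (w : V) : 0 < nn F w :=
  Finset.card_pos.2 ⟨w, mem_comp.2 (SimpleGraph.Reachable.refl w)⟩

lemma nn_le (F : SimpleGraph V) (w : V) : nn F w ≤ Fintype.card V := Finset.card_le_univ _

lemma bad_congr {κ d : ℕ} {F : SimpleGraph V} {w u : V} (h : F.Reachable w u) :
    Bad κ d F w ↔ Bad κ d F u := by
  constructor
  · rintro ⟨z, a, b, ha, hb, h1, h2⟩
    exact ⟨z, a, b, h.symm.trans ha, h.symm.trans hb, h1, by rw [← nn_eq h]; exact h2⟩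
  · rintro ⟨z, a, b, ha, hb, h1, h2⟩
    exact ⟨z, a, b, h.trans ha, h.trans hb, h1, by rw [nn_eq h]; exact h2⟩

lemma lk_adj {D : SimpleGraph V} {x y a b : V} :
    (lk D x y).Adj a b ↔ D.Adj a b ∨ ((a = x ∧ b = y ∨ a = y ∧ b = x) ∧ a ≠ b) := by
  simp [lk, SimpleGraph.edge_adj]

lemma ct_adj {D : SimpleGraph V} {x y a b : V} :
    (ct D x y).Adj a b ↔ D.Adj a b ∧ ¬ (a = x ∧ b = y ∨ a = y ∧ b = x) := by
  simp [ct, SimpleGraph.deleteEdges_adj]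

lemma lk_comm (D : SimpleGraph V) (x y : V) : lk D x y = lk D y x := by
  simp [lk, SimpleGraph.edge_comm]

lemma ct_comm (D : SimpleGraph V) (x y : V) : ct D x y = ct D y x := by
  simp [ct, Sym2.eq_swap]

lemma le_lk (D : SimpleGraph V) (x y : V) : D ≤ lk D x y := le_sup_left

lemma ct_le (D : SimpleGraph V) (x y : V) : ct D x y ≤ D := SimpleGraph.deleteEdges_le _

lemma lk_ct {F : SimpleGraph V} {x z : V} (h : F.Adj x z) : lk (ct F x z) x z = F := by
  ext a b
  rw [lk_adj, ct_adj]
  have := h.symm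
  have := h.ne
  grind

lemma not_reach_ct {F : SimpleGraph V} (hF : F.IsAcyclic) {x z : V} (h : F.Adj x z) :
    ¬ (ct F x z).Reachable x z := by
  have := (SimpleGraph.isAcyclic_iff_forall_adj_isBridge.1 hF) h
  exact SimpleGraph.isBridge_iff.1 this

lemma acyclic_ct {F : SimpleGraph V} (hF : F.IsAcyclic) (x z : V) : (ct F x z).IsAcyclic :=
  hF.anti (ct_le _ _ _)

lemma acyclic_lk {F : SimpleGraph V} (hF : F.IsAcyclic) {x z : V} (h : ¬ F.Reachable x z) :
    (lk F x z).IsAcyclic := SimpleGraph.IsAcyclic.sup_edge_of_not_reachable h hF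

lemma lk_adj_self {D : SimpleGraph V} {x y : V} (h : x ≠ y) : (lk D x y).Adj x y := by
  rw [lk_adj]; grind

lemma lk_reach {D : SimpleGraph V} {x y a b : V} (hxy : x ≠ y) :
    (lk D x y).Reachable a b ↔ D.Reachable a b ∨ (D.Reachable a x ∧ D.Reachable y b) ∨
      (D.Reachable a y ∧ D.Reachable x b) := by
  constructor
  · intro h
    rw [SimpleGraph.reachable_iff_reflTransGen] at h
    induction h with
    | refl => left; exact SimpleGraph.Reachable.refl _
    | tail _ hbc ih =>
      rename_i b c
      rw [lk_adj] at hbc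
      rcases hbc with h | ⟨⟨rfl, rfl⟩ | ⟨rfl, rfl⟩, _⟩
      · have h1 := h.reachable
        rcases ih with ih | ⟨i1, i2⟩ | ⟨i1, i2⟩
        · exact Or.inl (ih.trans h1)
        · exact Or.inr (Or.inl ⟨i1, i2.trans h1⟩)
        · exact Or.inr (Or.inr ⟨i1, i2.trans h1⟩)
      · have h0 := fun q => SimpleGraph.Reachable.refl (G := D) q
        rcases ih with ih | ⟨i1, i2⟩ | ⟨i1, i2⟩
        · exact Or.inr (Or.inl ⟨ih, h0 _⟩)
        · exact Or.inr (Or.inl ⟨i1, h0 _⟩)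
        · exact Or.inl i1
      · have h0 := fun q => SimpleGraph.Reachable.refl (G := D) q
        rcases ih with ih | ⟨i1, i2⟩ | ⟨i1, i2⟩
        · exact Or.inr (Or.inr ⟨ih, h0 _⟩)
        · exact Or.inl i1
        · exact Or.inr (Or.inr ⟨i1, h0 _⟩)
  · have hl := le_lk D x y
    have h1 : (lk D x y).Reachable x y := (lk_adj_self hxy).reachable
    rintro (h | ⟨h2, h3⟩ | ⟨h2, h3⟩)
    · exact h.mono hl
    · exact (h2.mono hl).trans (h1.trans (h3.mono hl))
    · exact (h2.mono hl).trans (h1.symm.trans (h3.mono hl))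

lemma dist_lip {H : SimpleGraph V} (f : V → ℕ) (hf : ∀ u w, H.Adj u w → f w ≤ f u + 1)
    {a b : V} (h : H.Reachable a b) : f b ≤ f a + H.dist a b := by
  obtain ⟨p, hp⟩ := h.exists_walk_length_eq_dist
  rw [← hp]
  clear hp h
  induction p with
  | nil => simp
  | cons h p ih => have := hf _ _ h; simp only [SimpleGraph.Walk.length_cons]; omega

lemma dist_adj_le {D : SimpleGraph V} {a u w : V} (h : D.Adj u w) :
    D.dist a w ≤ D.dist a u + 1 := by
  have := h.reachable.dist_triangle_right a
  rw [SimpleGraph.dist_eq_one_iff_adj.2 h] at this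
  exact this

/-- distances from the `x` side after adding the bridge `xy`. -/
lemma lk_dist_ge {D : SimpleGraph V} {x y a : V} (hxy : ¬ D.Reachable x y)
    (ha : D.Reachable x a) (b : V) (hb : D.Reachable y b) :
    D.dist a x + 1 + D.dist y b ≤ (lk D x y).dist a b := by
  have hne : x ≠ y := fun h => hxy (h ▸ SimpleGraph.Reachable.refl _)
  let f : V → ℕ := fun w => if D.Reachable x w then D.dist a w else
    if D.Reachable y w then D.dist a x + 1 + D.dist y w else 0
  have hf : ∀ u w, (lk D x y).Adj u w → f w ≤ f u + 1 := by
    intro u w h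
    rw [lk_adj] at h
    rcases h with h | ⟨⟨rfl, rfl⟩ | ⟨rfl, rfl⟩, _⟩
    · have h1 : D.Reachable x u ↔ D.Reachable x w :=
        ⟨fun h' => h'.trans h.reachable, fun h' => h'.trans h.symm.reachable⟩
      have h2 : D.Reachable y u ↔ D.Reachable y w :=
        ⟨fun h' => h'.trans h.reachable, fun h' => h'.trans h.symm.reachable⟩
      have h3 := dist_adj_le (a := a) h
      have h4 := dist_adj_le (a := y) h
      simp only [f, h1, h2]
      split_ifs <;> omega
    · simp [f, hxy]
    · simp [f, hxy]
      omega
  have hr : (lk D x y).Reachable a b := (lk_reach hne).2 (Or.inr (Or.inl ⟨ha.symm, hb⟩))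
  have := dist_lip f hf hr
  have hb' : ¬ D.Reachable x b := fun h => hxy (h.trans hb.symm)
  simpa [f, ha, hb, hb'] using this

lemma lk_dist_same' {D : SimpleGraph V} {x y a : V} (hxy : ¬ D.Reachable x y)
    (ha : ¬ D.Reachable y a) (b : V) (hb : D.Reachable a b) :
    D.dist a b ≤ (lk D x y).dist a b := by
  have hne : x ≠ y := fun h => hxy (h ▸ SimpleGraph.Reachable.refl _)
  let f : V → ℕ := fun w => if D.Reachable a w then D.dist a w else
    if D.Reachable y w then D.dist a x + 1 + D.dist y w else 0
  have hf : ∀ u w, (lk D x y).Adj u w → f w ≤ f u + 1 := by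
    intro u w h
    rw [lk_adj] at h
    have ha' : ¬ D.Reachable a y := fun h => ha h.symm
    rcases h with h | ⟨⟨rfl, rfl⟩ | ⟨rfl, rfl⟩, _⟩
    · have h1 : D.Reachable a u ↔ D.Reachable a w :=
        ⟨fun h' => h'.trans h.reachable, fun h' => h'.trans h.symm.reachable⟩
      have h2 : D.Reachable y u ↔ D.Reachable y w :=
        ⟨fun h' => h'.trans h.reachable, fun h' => h'.trans h.symm.reachable⟩
      have h3 := dist_adj_le (a := a) h
      have h4 := dist_adj_le (a := y) h
      simp only [f, h1, h2]
      split_ifs <;> omega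
    · by_cases h : D.Reachable a u
      · simp [f, ha', h]
      · have : D.dist a u = 0 := SimpleGraph.dist_eq_zero_of_not_reachable h
        simp [f, ha', h, this]
    · simp [f, ha']
      split_ifs
      · omega
      · exfalso; rename_i h1 h2; exact hxy h2.symm
      · omega
  have hr : (lk D x y).Reachable a b := hb.mono (le_lk _ _ _)
  have := dist_lip f hf hr
  simpa [f, hb] using this

lemma lk_dist_same {D : SimpleGraph V} {x y a b : V} (hxy : ¬ D.Reachable x y)
    (hb : D.Reachable a b) : (lk D x y).dist a b = D.dist a b := by
  refine le_antisymm (hb.dist_anti (le_lk _ _ _)) ?_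
  by_cases ha : D.Reachable y a
  · rw [lk_comm]
    exact lk_dist_same' (fun h => hxy h.symm) (fun h => hxy (h.trans ha.symm)) b hb
  · exact lk_dist_same' hxy ha b hb

lemma lk_dist_cross {D : SimpleGraph V} {x y a b : V} (hxy : ¬ D.Reachable x y)
    (ha : D.Reachable x a) (hb : D.Reachable y b) :
    (lk D x y).dist a b = D.dist x a + 1 + D.dist y b := by
  have hne : x ≠ y := fun h => hxy (h ▸ SimpleGraph.Reachable.refl _)
  have h1 := lk_dist_ge hxy ha b hb
  rw [D.dist_comm (u := a)] at h1
  refine le_antisymm ?_ h1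
  have hl := le_lk D x y
  have hadj := lk_adj_self (D := D) hne
  have e1 := (ha.symm.mono hl).dist_triangle_left b
  have e2 := hadj.reachable.dist_triangle_left b
  rw [SimpleGraph.dist_eq_one_iff_adj.2 hadj] at e2
  rw [lk_dist_same hxy hb] at e2
  rw [lk_dist_same hxy ha.symm, D.dist_comm] at e1
  omega

lemma dist_lt_nn {F : SimpleGraph V} {w a b : V} (ha : F.Reachable w a) (hb : F.Reachable w b) :
    F.dist a b + 1 ≤ nn F w := by
  obtain ⟨p, hp, hl⟩ := (ha.symm.trans hb).exists_path_of_dist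
  have h1 := hp.support_nodup
  have h2 : p.support.toFinset.card = p.length + 1 := by
    rw [List.toFinset_card_of_nodup h1, SimpleGraph.Walk.length_support]
  rw [← hl, ← h2]
  apply Finset.card_le_card
  intro u hu
  rw [List.mem_toFinset] at hu
  rw [mem_comp]
  exact ha.trans (p.takeUntil u hu).reachable

/-- sizes after linking -/
lemma comp_lk {D : SimpleGraph V} {x y : V} (hxy : ¬ D.Reachable x y) :
    comp (lk D x y) x = comp D x ∪ comp D y := by
  have hne : x ≠ y := fun h => hxy (h ▸ SimpleGraph.Reachable.refl _)
  ext u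
  simp only [mem_comp, Finset.mem_union, lk_reach hne]
  simp [hxy]

lemma disj_comp {D : SimpleGraph V} {x y : V} (hxy : ¬ D.Reachable x y) :
    Disjoint (comp D x) (comp D y) := by
  rw [Finset.disjoint_left]
  intro u h1 h2
  rw [mem_comp] at h1 h2
  exact hxy (h1.trans h2.symm)

lemma nn_lk {D : SimpleGraph V} {x y : V} (hxy : ¬ D.Reachable x y) :
    nn (lk D x y) x = nn D x + nn D y := by
  rw [nn, comp_lk hxy, Finset.card_union_of_disjoint (disj_comp hxy)]; rfl

lemma nn_lk' {D : SimpleGraph V} {x y : V} (hxy : ¬ D.Reachable x y) :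
    nn (lk D x y) y = nn D x + nn D y := by
  have hne : x ≠ y := fun h => hxy (h ▸ SimpleGraph.Reachable.refl _)
  rw [← nn_eq (lk_adj_self hne).reachable, nn_lk hxy]

lemma comp_lk_other {D : SimpleGraph V} {x y w : V} (hxy : ¬ D.Reachable x y)
    (h1 : ¬ D.Reachable x w) (h2 : ¬ D.Reachable y w) : comp (lk D x y) w = comp D w := by
  have hne : x ≠ y := fun h => hxy (h ▸ SimpleGraph.Reachable.refl _)
  ext u
  simp only [mem_comp, lk_reach hne]
  have h3 : ¬ D.Reachable w x := fun h => h1 h.symm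
  have h4 : ¬ D.Reachable w y := fun h => h2 h.symm
  simp [h3, h4]

lemma nn_mono {D F : SimpleGraph V} (h : D ≤ F) (w : V) : nn D w ≤ nn F w := by
  apply Finset.card_le_card
  intro u hu
  rw [mem_comp] at *
  exact hu.mono h

/-- In a forest distances of a subgraph agree. -/
lemma dist_sub {D F : SimpleGraph V} (hF : F.IsAcyclic) (h : D ≤ F) {a b : V}
    (hr : D.Reachable a b) : D.dist a b = F.dist a b := by
  obtain ⟨p, hp, hl⟩ := hr.exists_path_of_dist
  obtain ⟨q, hq, hl'⟩ := (hr.mono h).exists_path_of_dist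
  have := (hF.subsingleton_path a b).elim ⟨p.mapLe h, hp.mapLe h⟩ ⟨q, hq⟩
  have := congrArg (fun r : F.Path a b => r.1.length) this
  simp only [SimpleGraph.Walk.length_map, SimpleGraph.Walk.mapLe] at this
  omega

lemma bad_mono {κ d : ℕ} {D F : SimpleGraph V} (hF : F.IsAcyclic) (h : D ≤ F) {w : V}
    (hb : Bad κ d D w) : Bad κ d F w := by
  obtain ⟨z, a, b, ha, hb, h1, h2⟩ := hb
  refine ⟨z, a, b, ha.mono h, hb.mono h, ?_, ?_⟩
  · rwa [← dist_sub hF h (ha.symm.trans hb)]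
  · have := nn_mono h w; omega

lemma bad_other {κ d : ℕ} {D : SimpleGraph V} {x y w : V} (hxy : ¬ D.Reachable x y)
    (h1 : ¬ D.Reachable x w) (h2 : ¬ D.Reachable y w) :
    Bad κ d (lk D x y) w ↔ Bad κ d D w := by
  have hc := comp_lk_other hxy h1 h2
  have hn : nn (lk D x y) w = nn D w := by rw [nn, nn, hc]
  have hr : ∀ u, (lk D x y).Reachable w u ↔ D.Reachable w u := by
    intro u; rw [← mem_comp, ← mem_comp, hc]
  constructor
  · rintro ⟨z, a, b, ha, hb, h1, h2⟩
    rw [hr] at ha hb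
    refine ⟨z, a, b, ha, hb, ?_, by omega⟩
    rwa [lk_dist_same hxy (ha.symm.trans hb)] at h1
  · rintro ⟨z, a, b, ha, hb, h1, h2⟩
    refine ⟨z, a, b, (hr _).2 ha, (hr _).2 hb, ?_, by omega⟩
    rwa [lk_dist_same hxy (ha.symm.trans hb)]

/-- first edge from `x` toward `p`. -/
lemma exists_toward {F : SimpleGraph V} {x p : V} (h : F.Reachable x p) (hne : x ≠ p) :
    ∃ z, F.Adj x z ∧ (ct F x z).Reachable z p := by
  obtain ⟨q, hq⟩ := h.exists_isPath
  cases q with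
  | nil => exact absurd rfl hne
  | cons hadj q =>
    rename_i z
    refine ⟨z, hadj, ?_⟩
    rw [SimpleGraph.Walk.cons_isPath_iff] at hq
    refine ⟨q.toDeleteEdges {s(x, z)} ?_⟩
    intro e he
    rintro rfl
    exact hq.2 (q.fst_mem_support_of_mem_edges he)



/-- blue out-neighbourhoods -/
structure Pre (G : SimpleGraph V) (B : V → Finset V) : Prop where
  adj : ∀ u w, w ∈ B u → G.Adj u w
  asym : ∀ u w, w ∈ B u → u ∉ B w

structure Valid (G : SimpleGraph V) (k : ℕ) (B : V → Finset V) : Prop extends Pre G B where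
  deg : ∀ u, (B u).card ≤ k

/-- the red graph -/
def red (G : SimpleGraph V) (B : V → Finset V) : SimpleGraph V where
  Adj u w := G.Adj u w ∧ w ∉ B u ∧ u ∉ B w
  symm := ⟨fun _ _ h => ⟨h.1.symm, h.2.2, h.2.1⟩⟩
  loopless := ⟨fun _ h => h.1.ne rfl⟩

lemma red_adj {G : SimpleGraph V} {B : V → Finset V} {u w : V} :
    (red G B).Adj u w ↔ G.Adj u w ∧ w ∉ B u ∧ u ∉ B w := Iff.rfl

lemma swap {G : SimpleGraph V} {B : V → Finset V} {k : ℕ} (hB : Pre G B) {x z x0 y : V}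
    (hy : y ∈ B x0) (hz : (red G B).Adj x z)
    (hd : ∀ u, (B u).card + (if u = x then 1 else 0) ≤ k + (if u = x0 then 1 else 0)) :
    ∃ B', Valid G k B' ∧ red G B' = lk (ct (red G B) x z) x0 y ∧
      ∀ u, u ≠ x → u ≠ x0 → B' u = B u := by
  have h1 := hB.adj
  have h2 := hB.asym
  rw [red_adj] at hz
  obtain ⟨hz1, hz2, hz3⟩ := hz
  have hne := hz1.ne
  have hG := hz1.symm
  have hyG := h1 _ _ hy
  have hyne := hyG.ne
  have hyG' := hyG.symm
  have hy2 := h2 _ _ hy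
  let B' : V → Finset V := fun u =>
    if u = x then insert z (if u = x0 then (B u).erase y else B u)
      else (if u = x0 then (B u).erase y else B u)
  have hB' : ∀ u w, w ∈ B' u ↔ (u = x ∧ w = z) ∨ (w ∈ B u ∧ ¬ (u = x0 ∧ w = y)) := by
    intro u w
    simp only [B']
    split_ifs <;> grind
  refine ⟨B', ⟨⟨?_, ?_⟩, ?_⟩, ?_, ?_⟩
  · intro u w h
    rw [hB'] at h
    grind
  · intro u w h
    rw [hB'] at h ⊢
    grind
  · intro u
    have := hd u
    simp only [B']
    split_ifs with e1 e2 e2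
    · have h3 : y ∈ B u := e2 ▸ hy
      have h4 := Finset.card_insert_le z ((B u).erase y)
      have h5 := Finset.card_erase_add_one h3
      simp only [e1, e2, if_true] at this h4 h5 ⊢
      grind
    · have h4 := Finset.card_insert_le z (B u)
      simp only [e1, if_true] at this h4 ⊢
      grind
    · have h3 : y ∈ B u := e2 ▸ hy
      have h5 := Finset.card_erase_add_one h3
      grind
    · grind
  · ext a b
    rw [red_adj, lk_adj, ct_adj, red_adj, hB', hB']
    grind
  · intro u h3 h4
    simp [B', h3, h4]

lemma reduce {G : SimpleGraph V} {B : V → Finset V} {k : ℕ} (hB : Pre G B) {x z : V}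
    (hz : (red G B).Adj x z)
    (hd : ∀ u, (B u).card + (if u = x then 1 else 0) ≤ k) :
    ∃ B', Valid G k B' ∧ (red G B').edgeSet.ncard < (red G B).edgeSet.ncard := by
  have h1 := hB.adj
  have h2 := hB.asym
  have hz0 := hz
  rw [red_adj] at hz
  obtain ⟨hz1, hz2, hz3⟩ := hz
  have hG := hz1.symm
  have hne := hz1.ne
  let B' : V → Finset V := fun u => if u = x then insert z (B u) else B u
  have hB' : ∀ u w, w ∈ B' u ↔ (u = x ∧ w = z) ∨ w ∈ B u := by
    intro u w
    simp only [B']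
    split_ifs <;> grind
  refine ⟨B', ⟨⟨?_, ?_⟩, ?_⟩, ?_⟩
  · intro u w h
    rw [hB'] at h
    grind
  · intro u w h
    rw [hB'] at h ⊢
    grind
  · intro u
    have := hd u
    simp only [B']
    split_ifs with e1
    · have h4 := Finset.card_insert_le z (B u)
      simp only [e1, if_true] at this h4 ⊢
      grind
    · grind
  · apply Set.ncard_lt_ncard _ (Set.toFinite _)
    have hle : red G B' ≤ red G B := by
      intro a b h
      rw [red_adj, hB', hB'] at h
      rw [red_adj]
      tauto
    refine SimpleGraph.edgeSet_ssubset_edgeSet.2 (lt_of_le_of_ne hle ?_)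
    intro h
    rw [← h, red_adj, hB'] at hz0
    tauto

lemma edges_swap {F : SimpleGraph V} {x z x0 y : V} (hz : F.Adj x z) :
    (lk (ct F x z) x0 y).edgeSet.ncard ≤ F.edgeSet.ncard := by
  have h1 : (lk (ct F x z) x0 y).edgeSet ⊆ insert s(x0, y) (F.edgeSet \ {s(x, z)}) := by
    intro e
    induction e with
    | h a b =>
      rw [SimpleGraph.mem_edgeSet, lk_adj, ct_adj]
      simp only [Set.mem_insert_iff, Set.mem_diff, SimpleGraph.mem_edgeSet, Set.mem_singleton_iff,
        Sym2.eq, Sym2.rel_iff', Prod.mk.injEq, Prod.swap_prod_mk]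
      tauto
  have h2 := Set.ncard_le_ncard h1 (Set.toFinite _)
  have h3 := Set.ncard_insert_le s(x0, y) (F.edgeSet \ {s(x, z)})
  have h4 := Set.ncard_diff_singleton_add_one (s := F.edgeSet) (a := s(x, z)) hz (Set.toFinite _)
  omega

/-- flip one arc -/
lemma flip {G : SimpleGraph V} {B : V → Finset V} (hB : Pre G B) {a b : V} (hb : b ∈ B a) :
    ∃ B', Pre G B' ∧ red G B' = red G B ∧ (B' a).card + 1 = (B a).card ∧
      (B' b).card = (B b).card + 1 ∧ (∀ u, u ≠ a → u ≠ b → B' u = B u) ∧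
      (∀ u w, ¬ (u = a ∧ w = b) → w ∈ B u → w ∈ B' u) := by
  have h1 := hB.adj
  have h2 := hB.asym
  have hG := h1 _ _ hb
  have hG' := hG.symm
  have hne := hG.ne
  have hab := h2 _ _ hb
  let B' : V → Finset V := fun u => if u = a then (B a).erase b else if u = b then insert a (B b)
    else B u
  have hB' : ∀ u w, w ∈ B' u ↔ (u = b ∧ w = a) ∨ (w ∈ B u ∧ ¬ (u = a ∧ w = b)) := by
    intro u w
    simp only [B']
    split_ifs <;> grind
  refine ⟨B', ⟨?_, ?_⟩, ?_, ?_, ?_, ?_, ?_⟩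
  · intro u w h
    rw [hB'] at h
    grind
  · intro u w h
    rw [hB'] at h ⊢
    grind
  · ext u w
    rw [red_adj, red_adj, hB', hB']
    grind
  · simp only [B', if_true]
    exact Finset.card_erase_add_one hb
  · simp only [B', if_neg hne.symm, if_true]
    exact Finset.card_insert_of_notMem hab
  · intro u h3 h4
    simp [B', h3, h4]
  · intro u w h3 h4
    rw [hB']; tauto

structure Legal (κ d : ℕ) (G : SimpleGraph V) (B : V → Finset V) (t : ℕ) (v : ℕ → V) : Prop where
  pos : 0 < t
  bad : Bad κ d (red G B) (v 0)
  arc : ∀ j < t, 0 < j → ∃ i < j, ∃ u, (red G B).Reachable (v i) u ∧ v j ∈ B u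
  dis : ∀ i j, i < j → j < t → ¬ (red G B).Reachable (v i) (v j)

noncomputable def val (F : SimpleGraph V) (t : ℕ) (v : ℕ → V) (j : ℕ) : ℕ :=
  if j < t then nn F (v j) else Fintype.card V + 1

noncomputable def Phi (κ d : ℕ) (F : SimpleGraph V) : ℕ :=
  ∑ w, if Bad κ d F w then (Fintype.card V + 1) ^ (nn F w) else 0

structure Opt (κ d : ℕ) (G : SimpleGraph V) (B : V → Finset V) (t : ℕ) (v : ℕ → V) : Prop where
  valid : Valid G (κ + 1) B
  acyc : (red G B).IsAcyclic
  minE : ∀ B', Valid G (κ + 1) B' → (red G B).edgeSet.ncard ≤ (red G B').edgeSet.ncard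
  legal : Legal κ d G B t v
  minP : ∀ B', Valid G (κ + 1) B' → (red G B').IsAcyclic →
    (red G B').edgeSet.ncard ≤ (red G B).edgeSet.ncard → Phi κ d (red G B) ≤ Phi κ d (red G B')
  minL : ∀ B', Valid G (κ + 1) B' → (red G B').IsAcyclic →
    (red G B').edgeSet.ncard ≤ (red G B).edgeSet.ncard → Phi κ d (red G B') ≤ Phi κ d (red G B) →
    ∀ t' v', Legal κ d G B' t' v' → ∀ j < Fintype.card V,
      (∀ i < j, val (red G B') t' v' i = val (red G B) t v i) →
      val (red G B) t v j ≤ val (red G B') t' v' j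

lemma Legal.dis' {κ d : ℕ} {G : SimpleGraph V} {B : V → Finset V} {t : ℕ} {v : ℕ → V}
    (h : Legal κ d G B t v) {i j : ℕ} (hi : i < t) (hj : j < t) (hr : (red G B).Reachable (v i) (v j)) :
    i = j := by
  rcases lt_trichotomy i j with h1 | h1 | h1
  · exact absurd hr (h.dis _ _ h1 hj)
  · exact h1
  · exact absurd hr.symm (h.dis _ _ h1 hi)

lemma Legal.t_le {κ d : ℕ} {G : SimpleGraph V} {B : V → Finset V} {t : ℕ} {v : ℕ → V}
    (h : Legal κ d G B t v) : t ≤ Fintype.card V := by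
  have : Function.Injective (fun i : Fin t => v i) := by
    intro i j hij
    apply Fin.ext
    apply h.dis' i.2 j.2
    simp only at hij
    rw [hij]
  simpa using Fintype.card_le_of_injective _ this

/-- path reversal -/
lemma rev {κ d : ℕ} {G : SimpleGraph V} {B : V → Finset V} {t : ℕ} {v : ℕ → V}
    (hB : Pre G B) (h : Legal κ d G B t v) : ∀ j, 0 < j → j < t → ∃ i0 < j, ∃ x B',
      (red G B).Reachable (v i0) x ∧ (x ≠ v i0 ∨ i0 = 0) ∧ Pre G B' ∧ red G B' = red G B ∧
      (B' x).card + 1 = (B x).card ∧ (B' (v j)).card = (B (v j)).card + 1 ∧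
      (∀ u, u ≠ x → u ≠ v j → (B' u).card = (B u).card) ∧
      (∀ u, u ≠ x → (∀ i, i0 < i → i ≤ j → u ≠ v i) → B' u = B u) ∧
      (∀ i, j < i → i < t → ∀ u, v i ∈ B u → v i ∈ B' u) := by
  intro j
  induction j using Nat.strong_induction_on with
  | _ j ih =>
    intro hj0 hjt
    obtain ⟨p, hp, u, hu, huv⟩ := h.arc j hjt hj0
    have hune : ∀ i, p < i → i < t → u ≠ v i := by
      intro i h1 h2 h3
      exact h.dis p i h1 h2 (h3 ▸ hu)
    by_cases hc : u ≠ v p ∨ p = 0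
    · obtain ⟨B', h1, h2, h3, h4, h5, h6⟩ := flip hB huv
      refine ⟨p, hp, u, B', hu, hc, h1, h2, h3, h4, ?_, ?_, ?_⟩
      · intro w hw1 hw2; rw [h5 w hw1 hw2]
      · intro w hw1 hw2; exact h5 w hw1 (hw2 j hp le_rfl)
      · intro i hi1 hi2 w hw
        apply h6 w _ _ hw
        rintro ⟨_, e⟩
        exact h.dis j i hi1 hi2 (e ▸ SimpleGraph.Reachable.refl _)
    · push Not at hc
      obtain ⟨rfl, hp0⟩ := hc
      obtain ⟨i0, hi0, x, B1, g1, g2, g3, g4, g5, g6, g7, g8, g9⟩ :=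
        ih p hp (Nat.pos_of_ne_zero hp0) (by omega)
      have hvj := g9 j hp hjt _ huv
      obtain ⟨B', h1, h2, h3, h4, h5, h6⟩ := flip g3 hvj
      have hxi : ∀ i, i0 < i → i < t → x ≠ v i := by
        intro i e1 e2 e3
        exact h.dis i0 i e1 e2 (e3 ▸ g1)
      have hxj := hxi j (by omega) hjt
      have hxp := hxi p (by omega) (by omega)
      have hpj := hune j hp hjt
      refine ⟨i0, by omega, x, B', g1, g2, h1, h2.trans g4, ?_, ?_, ?_, ?_, ?_⟩
      · rw [h5 x hxp hxj]; exact g5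
      · rw [h4, g7 _ hxj.symm hpj.symm]
      · intro w e1 e2
        by_cases e3 : w = v p
        · rw [e3]; omega
        · rw [h5 w e3 e2, g7 w e1 e3]
      · intro w e1 e2
        rw [h5 w (e2 p (by omega) (by omega)) (e2 j (by omega) le_rfl)]
        exact g8 w e1 (fun i i1 i2 => e2 i i1 (by omega))
      · intro i i1 i2 w hw
        apply h6 w _ _ (g9 i (by omega) i2 w hw)
        rintro ⟨_, e⟩
        exact h.dis j i i1 i2 (e ▸ SimpleGraph.Reachable.refl _)

lemma bad_ne {κ d : ℕ} {F : SimpleGraph V} {w : V} (h : Bad κ d F w) (x : V) (hx : F.Reachable w x) :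
    ∃ z, F.Adj x z := by
  obtain ⟨z, a, b, ha, hb, h1, h2⟩ := h
  have : a ≠ b := by rintro rfl; simp at h1
  by_cases hax : x = a
  · have : x ≠ b := by rw [hax]; exact this
    obtain ⟨q, hq, _⟩ := exists_toward (hx.symm.trans hb) this
    exact ⟨q, hq⟩
  · obtain ⟨q, hq, _⟩ := exists_toward (hx.symm.trans ha) hax
    exact ⟨q, hq⟩

lemma Opt.deg {κ d : ℕ} {G : SimpleGraph V} {B : V → Finset V} {t : ℕ} {v : ℕ → V}
    (h : Opt κ d G B t v) {j : ℕ} (hj : j < t) {w : V} (hw : (red G B).Reachable (v j) w) :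
    (B w).card = κ + 1 := by
  have hle := h.valid.deg w
  by_contra hne
  have hlt : (B w).card + 1 ≤ κ + 1 := by omega
  by_cases hz : ∃ z, (red G B).Adj w z
  · obtain ⟨z, hz⟩ := hz
    obtain ⟨B', h1, h2⟩ := reduce h.valid.toPre (k := κ + 1) hz (by
      intro u
      have := h.valid.deg u
      split_ifs with e
      · rw [e]; omega
      · omega)
    have := h.minE B' h1
    omega
  · have hj0 : 0 < j := by
      rcases Nat.eq_zero_or_pos j with rfl | h0
      · exact absurd (bad_ne h.legal.bad w hw) hz
      · exact h0
    have hwj : w = v j := by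
      by_contra hwj
      obtain ⟨z, hz', _⟩ := exists_toward hw.symm hwj
      exact hz ⟨z, hz'⟩
    subst hwj
    obtain ⟨i0, hi0, x, B1, g1, g2, g3, g4, g5, g6, g7, g8, g9⟩ := rev h.valid.toPre h.legal j hj0 hj
    have hx : ∃ z, (red G B).Adj x z := by
      by_cases e : x = v i0
      · have : i0 = 0 := by tauto
        subst this
        exact bad_ne h.legal.bad x g1
      · obtain ⟨z, hz', _⟩ := exists_toward g1.symm e
        exact ⟨z, hz'⟩
    obtain ⟨z, hz'⟩ := hx
    rw [← g4] at hz'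
    have hxj : x ≠ v j := by
      rintro rfl
      exact h.legal.dis _ _ hi0 hj g1
    obtain ⟨B', h1, h2⟩ := reduce g3 (k := κ + 1) hz' (by
      intro u
      have := h.valid.deg u
      split_ifs with e
      · rw [e]; have := h.valid.deg x; omega
      · by_cases e2 : u = v j
        · rw [e2]; omega
        · rw [g7 u e e2]; omega)
    have := h.minE B' h1
    rw [g4] at h2
    omega

lemma Opt.closed {κ d : ℕ} {G : SimpleGraph V} {B : V → Finset V} {t : ℕ} {v : ℕ → V}
    (h : Opt κ d G B t v) {i : ℕ} (hi : i < t) {u w : V} (hu : (red G B).Reachable (v i) u)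
    (hw : w ∈ B u) : ∃ j < t, (red G B).Reachable (v j) w := by
  by_contra hcon
  push Not at hcon
  let v' : ℕ → V := fun j => if j < t then v j else w
  have hv' : ∀ j < t, v' j = v j := fun j hj => by simp [v', hj]
  have hv't : v' t = w := by simp [v']
  have hL : Legal κ d G B (t + 1) v' := by
    refine ⟨by omega, ?_, ?_, ?_⟩
    · rw [hv' 0 h.legal.pos]; exact h.legal.bad
    · intro j hj hj0
      by_cases hjt : j < t
      · obtain ⟨i, hi, u, h1, h2⟩ := h.legal.arc j hjt hj0
        refine ⟨i, hi, u, ?_, ?_⟩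
        · rw [hv' i (by omega)]; exact h1
        · rw [hv' j hjt]; exact h2
      · have : j = t := by omega
        subst this
        refine ⟨i, hi, u, ?_, ?_⟩
        · rw [hv' i hi]; exact hu
        · rw [hv't]; exact hw
    · intro a b hab hb
      rw [hv' a (by omega)]
      by_cases hbt : b < t
      · rw [hv' b hbt]; exact h.legal.dis a b hab hbt
      · have : b = t := by omega
        subst this
        rw [hv't]; exact hcon a (by omega)
  have hle := hL.t_le
  have := h.minL B h.valid h.acyc le_rfl le_rfl (t + 1) v' hL t (by omega) (by
    intro j hj
    simp [val, hj, show j < t + 1 by omega, hv' j hj])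
  have h2 := nn_le (red G B) w
  simp [val, hv't] at this
  omega



lemma Phi_le {κ d : ℕ} {F F' : SimpleGraph V}
    (h : ∀ w, Bad κ d F' w → Bad κ d F w ∧ nn F' w ≤ nn F w) : Phi κ d F' ≤ Phi κ d F := by
  apply Finset.sum_le_sum
  intro w _
  by_cases hb : Bad κ d F' w
  · obtain ⟨h1, h2⟩ := h w hb
    rw [if_pos hb, if_pos h1]
    exact Nat.pow_le_pow_right (by omega) h2
  · rw [if_neg hb]; exact Nat.zero_le _

lemma Phi_lt {κ d : ℕ} {F F' : SimpleGraph V} {x : V} (hx : Bad κ d F x)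
    (h : ∀ w, Bad κ d F' w → nn F' w < nn F x ∨ (w ≠ x ∧ Bad κ d F w ∧ nn F' w ≤ nn F w)) :
    Phi κ d F' < Phi κ d F := by
  have hpos := nn_pos F x
  obtain ⟨n, hn⟩ : ∃ n, nn F x = n + 1 := ⟨nn F x - 1, by omega⟩
  set M := Fintype.card V + 1 with hM
  have key : ∀ w, (if Bad κ d F' w then M ^ (nn F' w) else 0) ≤
      (if w = x then 0 else (if Bad κ d F w then M ^ (nn F w) else 0)) + M ^ n := by
    intro w
    by_cases hb : Bad κ d F' w
    · rw [if_pos hb]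
      rcases h w hb with h1 | ⟨h1, h2, h3⟩
      · have : M ^ (nn F' w) ≤ M ^ n := Nat.pow_le_pow_right (by omega) (by omega)
        omega
      · rw [if_neg h1, if_pos h2]
        have : M ^ (nn F' w) ≤ M ^ (nn F w) := Nat.pow_le_pow_right (by omega) h3
        omega
    · rw [if_neg hb]; exact Nat.zero_le _
  have h1 := Finset.sum_le_sum (fun w (_ : w ∈ (univ : Finset V)) => key w)
  rw [Finset.sum_add_distrib, Finset.sum_const, Finset.card_univ, smul_eq_mul] at h1
  have h2 : Phi κ d F = M ^ (n + 1) +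
      ∑ w, (if w = x then 0 else (if Bad κ d F w then M ^ (nn F w) else 0)) := by
    rw [Phi, ← Finset.add_sum_erase _ _ (Finset.mem_univ x), if_pos hx, hn,
      ← Finset.add_sum_erase (s := univ) (f := fun w => (if w = x then 0 else (if Bad κ d F w then M ^ (nn F w) else 0))) (Finset.mem_univ x)]
    simp only [if_true, zero_add]
    congr 1
    apply Finset.sum_congr rfl
    intro w hw
    rw [if_neg (Finset.ne_of_mem_erase hw)]
  have h3 : 0 < M ^ n := Nat.pow_pos (by omega)
  have h4 : M ^ (n + 1) = Fintype.card V * M ^ n + M ^ n := by rw [pow_succ, hM]; ring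
  have h5 : Phi κ d F' ≤ (∑ w, (if w = x then 0 else (if Bad κ d F w then M ^ (nn F w) else 0))) +
    Fintype.card V * M ^ n := h1
  omega

lemma nn_cut {F : SimpleGraph V} (hF : F.IsAcyclic) {x z : V} (hz : F.Adj x z) :
    nn F x = nn (ct F x z) x + nn (ct F x z) z := by
  have := nn_lk (not_reach_ct hF hz)
  rwa [lk_ct hz] at this

lemma reach_cut {F : SimpleGraph V} {x z w : V} (hz : F.Adj x z)
    (hw : F.Reachable x w) : (ct F x z).Reachable x w ∨ (ct F x z).Reachable z w := by
  have h1 : (lk (ct F x z) x z).Reachable x w := by rwa [lk_ct hz]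
  rw [lk_reach hz.ne] at h1
  tauto

lemma reach_cut_other {F : SimpleGraph V} (hF : F.IsAcyclic) {x z w : V} (hz : F.Adj x z)
    (hw : ¬ F.Reachable x w) : comp (ct F x z) w = comp F w := by
  have h2 := not_reach_ct hF hz
  have h3 := comp_lk_other h2 (w := w) (fun h => hw (h.mono (ct_le _ _ _)))
    (fun h => hw (hz.reachable.trans (h.mono (ct_le _ _ _))))
  rw [lk_ct hz] at h3
  exact h3.symm

lemma phi_swap {κ d : ℕ} {F : SimpleGraph V} (hF : F.IsAcyclic) {x z x0 y : V} (hz : F.Adj x z)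
    (hy : ¬ F.Reachable x0 y)
    (hb : Bad κ d (lk (ct F x z) x0 y) x0 → Bad κ d F x ∧ nn (lk (ct F x z) x0 y) x0 < nn F x) :
    Phi κ d (lk (ct F x z) x0 y) ≤ Phi κ d F ∧
      (Bad κ d F x → Phi κ d (lk (ct F x z) x0 y) < Phi κ d F) := by
  set D := ct F x z with hD
  have hy' : ¬ D.Reachable x0 y := fun h => hy (h.mono (ct_le _ _ _))
  have hne : x0 ≠ y := fun h => hy (h ▸ SimpleGraph.Reachable.refl _)
  have key : ∀ w, Bad κ d (lk D x0 y) w →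
      (Bad κ d F x ∧ nn (lk D x0 y) w < nn F x) ∨
      (Bad κ d F w ∧ nn (lk D x0 y) w = nn D w ∧ nn D w ≤ nn F w) := by
    intro w hw
    by_cases h1 : (lk D x0 y).Reachable x0 w
    · left
      rw [← bad_congr h1] at hw
      rw [← nn_eq h1]
      exact hb hw
    · right
      rw [lk_reach hne] at h1
      have h2 : ¬ D.Reachable x0 w := by tauto
      have h3 : ¬ D.Reachable y w := by
        intro h; apply h1; right; left; exact ⟨SimpleGraph.Reachable.refl _, h⟩
      rw [bad_other hy' h2 h3] at hw
      refine ⟨bad_mono hF (ct_le _ _ _) hw, ?_, nn_mono (ct_le _ _ _) _⟩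
      rw [nn, nn, comp_lk_other hy' h2 h3]
  have hlt : nn D x < nn F x := by
    have h1 := nn_cut hF hz
    have h2 := nn_pos (ct F x z) z
    rw [← hD] at h1 h2
    omega
  by_cases hx : Bad κ d F x
  · have : Phi κ d (lk D x0 y) < Phi κ d F := by
      apply Phi_lt hx
      intro w hw
      by_cases hwx : w = x
      · left
        rcases key w hw with ⟨_, h1⟩ | ⟨h1, h2, h3⟩
        · exact h1
        · rw [h2, hwx]; exact hlt
      · rcases key w hw with ⟨_, h1⟩ | ⟨h1, h2, h3⟩
        · exact Or.inl h1
        · exact Or.inr ⟨hwx, h1, by omega⟩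
    exact ⟨this.le, fun _ => this⟩
  · refine ⟨Phi_le ?_, fun h => absurd h hx⟩
    intro w hw
    rcases key w hw with ⟨h1, _⟩ | ⟨h1, h2, h3⟩
    · exact absurd h1 hx
    · exact ⟨h1, by omega⟩

section opt
variable {κ d : ℕ} {G : SimpleGraph V} {B : V → Finset V} {t : ℕ} {v : ℕ → V}

lemma Opt.trunc (h : Opt κ d G B t v) {B' : V → Finset V} (hV : Valid G (κ + 1) B')
    (hA : (red G B').IsAcyclic) (hE : (red G B').edgeSet.ncard ≤ (red G B).edgeSet.ncard)
    (hP : Phi κ d (red G B') ≤ Phi κ d (red G B)) {j : ℕ} (hj0 : 0 < j) (hj : j < t)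
    (hc : ∀ i < j, comp (red G B') (v i) = comp (red G B) (v i))
    (hb : Bad κ d (red G B') (v 0))
    (hu : ∀ i < j, ∀ u, (red G B).Reachable (v i) u → B' u = B u)
    (hn : nn (red G B') (v j) < nn (red G B) (v j)) : False := by
  have hr : ∀ i < j, ∀ u, (red G B').Reachable (v i) u ↔ (red G B).Reachable (v i) u := by
    intro i hi u
    rw [← mem_comp, ← mem_comp, hc i hi]
  have hL : Legal κ d G B' (j + 1) v := by
    refine ⟨by omega, hb, ?_, ?_⟩
    · intro m hm hm0
      obtain ⟨i, hi, u, h1, h2⟩ := h.legal.arc m (by omega) hm0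
      refine ⟨i, hi, u, (hr i (by omega) u).2 h1, ?_⟩
      rw [hu i (by omega) u h1]; exact h2
    · intro a b hab hbj hab'
      rw [hr a (by omega)] at hab'
      exact h.legal.dis a b hab (by omega) hab'
  have := h.minL B' hV hA hE hP (j + 1) v hL j (lt_of_lt_of_le hj h.legal.t_le) (by
    intro i hi
    rw [val, val, if_pos (by omega), if_pos (by omega), nn, nn, hc i hi])
  rw [val, val, if_pos hj, if_pos (by omega)] at this
  omega

lemma Opt.T1 (h : Opt κ d G B t v) {j i : ℕ} (hj : j < t) (hji : j < i) (hi : i < t) {x z : V}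
    (hx : (red G B).Reachable (v j) x) (hy : v i ∈ B x) (hz : (red G B).Adj x z)
    (h1 : Bad κ d (lk (ct (red G B) x z) x (v i)) x →
      Bad κ d (red G B) x ∧ nn (lk (ct (red G B) x z) x (v i)) x < nn (red G B) x)
    (h2 : j = 0 ∨ (ct (red G B) x z).Reachable z (v j) ∨
      nn (lk (ct (red G B) x z) x (v i)) x < nn (red G B) x) : False := by
  have hxy : ¬ (red G B).Reachable x (v i) := fun e => h.legal.dis j i hji hi (hx.trans e)
  have hxy' : ¬ (ct (red G B) x z).Reachable x (v i) := fun e => hxy (e.mono (ct_le _ _ _))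
  have hne : x ≠ v i := fun e => hxy (e ▸ SimpleGraph.Reachable.refl _)
  obtain ⟨B', g1, g2, g3⟩ := swap (k := κ + 1) h.valid.toPre hy hz (by
    intro u; have := h.valid.deg u; omega)
  have gA : (red G B').IsAcyclic := by
    rw [g2]; exact acyclic_lk (acyclic_ct h.acyc _ _) hxy'
  have gE : (red G B').edgeSet.ncard ≤ (red G B).edgeSet.ncard := by
    rw [g2]; exact edges_swap hz
  obtain ⟨p1, p2⟩ := phi_swap (κ := κ) (d := d) h.acyc hz hxy h1
  rw [← g2] at p1 p2
  have hM := h.minP B' g1 gA gE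
  by_cases hbx : Bad κ d (red G B) x
  · have := p2 hbx; omega
  have hj0 : 0 < j := by
    rcases Nat.eq_zero_or_pos j with rfl | h0
    · exact absurd ((bad_congr hx).1 h.legal.bad) hbx
    · exact h0
  have hoth : ∀ m < j, ¬ (red G B).Reachable x (v m) ∧ ¬ (red G B).Reachable (v i) (v m) := by
    intro m hm
    exact ⟨fun e => h.legal.dis m j hm hj (hx.trans e).symm,
      fun e => h.legal.dis m i (by omega) hi e.symm⟩
  have hD := ct_le (red G B) x z
  refine h.trunc g1 gA gE p1 hj0 hj ?_ ?_ ?_ ?_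
  · intro m hm
    rw [g2, comp_lk_other hxy' (fun e => (hoth m hm).1 (e.mono hD)) (fun e => (hoth m hm).2 (e.mono hD)),
      reach_cut_other h.acyc hz (hoth m hm).1]
  · have hm := hoth 0 hj0
    rw [g2, bad_other hxy' (fun e => hm.1 (e.mono hD)) (fun e => hm.2 (e.mono hD))]
    have := h.legal.bad
    rw [← lk_ct hz] at this
    rwa [bad_other (not_reach_ct h.acyc hz) (fun e => hm.1 (e.mono hD))
      (fun e => hm.1 (hz.reachable.trans (e.mono hD)))] at this
  · intro m hm u hu
    have : u ≠ x := by
      rintro rfl; exact (hoth m hm).1 hu.symm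
    exact g3 u this this
  · have hcz : (ct (red G B) x z).Reachable z (v j) →
        nn (red G B') (v j) < nn (red G B) (v j) := by
      intro e
      have n1 : ¬ (ct (red G B) x z).Reachable x (v j) := fun e' =>
        not_reach_ct h.acyc hz (e'.trans e.symm)
      have n2 : ¬ (ct (red G B) x z).Reachable (v i) (v j) := fun e' =>
        h.legal.dis j i hji hi (e'.mono hD).symm
      have e1 : nn (red G B') (v j) = nn (ct (red G B) x z) z := by
        rw [nn_eq e, g2, nn, nn, comp_lk_other hxy' n1 n2]
      have e2 := nn_cut h.acyc hz
      have e3 := nn_pos (ct (red G B) x z) x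
      rw [nn_eq hx]; omega
    rcases h2 with h2 | h2 | h2
    · omega
    · exact hcz h2
    · rcases reach_cut hz hx.symm with e | e
      · rw [nn_eq hx, g2, ← nn_eq (e.mono (le_lk _ _ _))]; exact h2
      · exact hcz e

lemma Opt.T2 (h : Opt κ d G B t v) {j i : ℕ} (hj0 : 0 < j) (hj : j < t) (hji : j < i) (hi : i < t)
    (hy : v i ∈ B (v j)) (hb : ¬ Bad κ d (lk (red G B) (v j) (v i)) (v j)) : False := by
  have hxy : ¬ (red G B).Reachable (v j) (v i) := h.legal.dis j i hji hi
  obtain ⟨i0, hi0, x, B1, q1, q2, q3, q4, q5, q6, q7, q8, q9⟩ := rev h.valid.toPre h.legal j hj0 hj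
  have hz : ∃ z, (red G B).Adj x z ∧ (i0 ≠ 0 → (ct (red G B) x z).Reachable z (v i0)) := by
    by_cases e : x = v i0
    · have : i0 = 0 := by tauto
      subst this
      obtain ⟨z, hz⟩ := bad_ne h.legal.bad x q1
      exact ⟨z, hz, by simp⟩
    · obtain ⟨z, hz, hz'⟩ := exists_toward q1.symm e
      exact ⟨z, hz, fun _ => hz'⟩
  obtain ⟨z, hz, hzv⟩ := hz
  have hxy' : ¬ (ct (red G B) x z).Reachable (v j) (v i) := fun e => hxy (e.mono (ct_le _ _ _))
  have hxj : x ≠ v j := by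
    rintro rfl
    exact h.legal.dis _ _ hi0 hj q1
  obtain ⟨B', g1, g2, g3⟩ := swap (k := κ + 1) (x0 := v j) (y := v i) q3 (q9 i hji hi _ hy) (q4 ▸ hz) (by
    intro u
    have := h.valid.deg u
    by_cases e1 : u = x
    · subst e1
      rw [if_pos rfl, if_neg hxj]; omega
    · by_cases e2 : u = v j
      · subst e2
        rw [if_neg e1, if_pos rfl]; omega
      · rw [if_neg e1, if_neg e2, q7 u e1 e2]; omega)
  rw [q4] at g2
  have gA : (red G B').IsAcyclic := by
    rw [g2]; exact acyclic_lk (acyclic_ct h.acyc _ _) hxy'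
  have gE : (red G B').edgeSet.ncard ≤ (red G B).edgeSet.ncard := by
    rw [g2]; exact edges_swap hz
  obtain ⟨p1, p2⟩ := phi_swap (κ := κ) (d := d) h.acyc hz hxy (by
    intro e
    exfalso
    apply hb
    refine bad_mono (acyclic_lk h.acyc hxy) ?_ e
    intro a b
    rw [lk_adj, lk_adj, ct_adj]
    tauto)
  rw [← g2] at p1 p2
  have hM := h.minP B' g1 gA gE
  by_cases hbx : Bad κ d (red G B) x
  · have := p2 hbx; omega
  have hi00 : 0 < i0 := by
    rcases Nat.eq_zero_or_pos i0 with rfl | h0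
    · exact absurd ((bad_congr q1).1 h.legal.bad) hbx
    · exact h0
  have hD := ct_le (red G B) x z
  have hoth : ∀ m < i0, ¬ (red G B).Reachable x (v m) ∧ ¬ (red G B).Reachable (v j) (v m) ∧
      ¬ (red G B).Reachable (v i) (v m) := by
    intro m hm
    exact ⟨fun e => h.legal.dis m i0 hm (by omega) (q1.trans e).symm,
      fun e => h.legal.dis m j (by omega) hj e.symm,
      fun e => h.legal.dis m i (by omega) hi e.symm⟩
  refine h.trunc g1 gA gE p1 hi00 (by omega) ?_ ?_ ?_ ?_
  · intro m hm
    rw [g2, comp_lk_other hxy' (fun e => (hoth m hm).2.1 (e.mono hD))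
      (fun e => (hoth m hm).2.2 (e.mono hD)), reach_cut_other h.acyc hz (hoth m hm).1]
  · have hm := hoth 0 hi00
    rw [g2, bad_other hxy' (fun e => hm.2.1 (e.mono hD)) (fun e => hm.2.2 (e.mono hD))]
    have := h.legal.bad
    rw [← lk_ct hz] at this
    rwa [bad_other (not_reach_ct h.acyc hz) (fun e => hm.1 (e.mono hD))
      (fun e => hm.1 (hz.reachable.trans (e.mono hD)))] at this
  · intro m hm u hu
    have e1 : u ≠ x := by
      rintro rfl; exact (hoth m hm).1 hu.symm
    have e2 : ∀ a, i0 < a → a ≤ j → u ≠ v a := by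
      rintro a ha1 ha2 rfl
      exact h.legal.dis m a (by omega) (by omega) hu
    rw [g3 u e1 (e2 j hi0 le_rfl), q8 u e1 e2]
  · have e := hzv (by omega)
    have n1 : ¬ (ct (red G B) x z).Reachable (v j) (v i0) := fun e' =>
      h.legal.dis i0 j hi0 hj (e'.mono hD).symm
    have n2 : ¬ (ct (red G B) x z).Reachable (v i) (v i0) := fun e' =>
      h.legal.dis i0 i (by omega) hi (e'.mono hD).symm
    have e1 : nn (red G B') (v i0) = nn (ct (red G B) x z) z := by
      rw [nn_eq e, g2, nn, nn, comp_lk_other hxy' n1 n2]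
    have e2 := nn_cut h.acyc hz
    have e3 := nn_pos (ct (red G B) x z) x
    rw [nn_eq q1]; omega


lemma lk_wit {D : SimpleGraph V} {x y a b : V} (hxy : ¬ D.Reachable x y)
    (ha : (lk D x y).Reachable x a) (hb : (lk D x y).Reachable x b) :
    (D.Reachable x a ∧ D.Reachable x b) ∨
      ∃ p, D.Reachable x p ∧ (lk D x y).dist a b ≤ D.dist x p + nn D y := by
  have hne : x ≠ y := fun h => hxy (h ▸ SimpleGraph.Reachable.refl _)
  have ha' : D.Reachable x a ∨ D.Reachable y a := by
    rw [lk_reach hne] at ha; tauto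
  have hb' : D.Reachable x b ∨ D.Reachable y b := by
    rw [lk_reach hne] at hb; tauto
  rcases ha' with ha | ha <;> rcases hb' with hb | hb
  · exact Or.inl ⟨ha, hb⟩
  · right
    refine ⟨a, ha, ?_⟩
    rw [lk_dist_cross hxy ha hb]
    have := dist_lt_nn (SimpleGraph.Reachable.refl (G := D) y) hb
    omega
  · right
    refine ⟨b, hb, ?_⟩
    rw [SimpleGraph.dist_comm, lk_dist_cross hxy hb ha]
    have := dist_lt_nn (SimpleGraph.Reachable.refl (G := D) y) ha
    omega
  · right
    refine ⟨x, SimpleGraph.Reachable.refl _, ?_⟩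
    rw [lk_dist_same hxy (ha.symm.trans hb)]
    have := dist_lt_nn ha hb
    omega

lemma nn_cut_other {F : SimpleGraph V} (hF : F.IsAcyclic) {x z w : V} (hz : F.Adj x z)
    (hw : ¬ F.Reachable x w) : nn (ct F x z) w = nn F w := by
  rw [nn, nn, reach_cut_other hF hz hw]

lemma lk_mono {D F : SimpleGraph V} (h : D ≤ F) (x y : V) : lk D x y ≤ lk F x y :=
  sup_le_sup_right h _

lemma Opt.nreach (h : Opt κ d G B t v) {j i : ℕ} (hj : j < t) (hji : j < i) (hi : i < t) {x : V}
    (hx : (red G B).Reachable (v j) x) (hy : v i ∈ B x)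
    : ¬ (red G B).Reachable x (v i) := fun e => h.legal.dis j i hji hi (hx.trans e)

lemma Opt.A (h : Opt κ d G B t v) {j i : ℕ} (hj : j < t) (hji : j < i) (hi : i < t) {x : V}
    (hx : (red G B).Reachable (v j) x) (hy : v i ∈ B x)
    : Bad κ d (lk (red G B) x (v i)) x := by
  have hxy := h.nreach hj hji hi hx hy
  by_contra hb
  by_cases hj0 : j = 0
  · subst hj0
    exact hb (bad_mono (acyclic_lk h.acyc hxy) (le_lk _ _ _) ((bad_congr hx).1 h.legal.bad))
  by_cases hxj : x = v j
  · subst hxj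
    exact h.T2 (by omega) hj hji hi hy hb
  · obtain ⟨z, hz, hzv⟩ := exists_toward hx.symm hxj
    refine h.T1 hj hji hi hx hy hz ?_ (Or.inr (Or.inl hzv))
    intro e
    exact absurd (bad_mono (acyclic_lk h.acyc hxy) (lk_mono (ct_le _ _ _) _ _) e) hb

lemma Opt.Bd (h : Opt κ d G B t v) {j i : ℕ} (hj : j < t) (hji : j < i) (hi : i < t) {x : V}
    (hx : (red G B).Reachable (v j) x) (hy : v i ∈ B x)
    {ζ : ℕ} {a b : V} (ha : (lk (red G B) x (v i)).Reachable x a)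
    (hb : (lk (red G B) x (v i)).Reachable x b) (h1 : 2 * ζ + 1 ≤ (lk (red G B) x (v i)).dist a b) :
    ζ < nn (red G B) (v i) := by
  have hxy := h.nreach hj hji hi hx hy
  by_contra hcon
  push Not at hcon
  have hp : ∃ p, (red G B).Reachable x p ∧ ζ + 1 ≤ (red G B).dist x p := by
    rcases lk_wit hxy ha hb with ⟨e1, e2⟩ | ⟨p, e1, e2⟩
    · rw [lk_dist_same hxy (e1.symm.trans e2)] at h1
      have h3 : (red G B).dist a b ≤ (red G B).dist a x + (red G B).dist x b := SimpleGraph.Reachable.dist_triangle_left e1.symm _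
      rw [SimpleGraph.dist_comm (u := a) (v := x)] at h3
      by_cases h4 : ζ + 1 ≤ (red G B).dist x a
      · exact ⟨a, e1, h4⟩
      · exact ⟨b, e2, by omega⟩
    · exact ⟨p, e1, by omega⟩
  obtain ⟨p, hp, hpd⟩ := hp
  have hxp : x ≠ p := by rintro rfl; simp at hpd
  obtain ⟨z, hz, hzp⟩ := exists_toward hp hxp
  have hD := not_reach_ct h.acyc hz
  have hxy' : ¬ (ct (red G B) x z).Reachable x (v i) := fun e => hxy (e.mono (ct_le _ _ _))
  have hny := nn_cut_other h.acyc hz hxy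
  have hnx := nn_cut h.acyc hz
  have hnz := dist_lt_nn (SimpleGraph.Reachable.refl (G := ct (red G B) x z) z) hzp
  have hcr : ∀ q, (ct (red G B) x z).Reachable x q → (red G B).dist q p = (ct (red G B) x z).dist x q + 1 + (ct (red G B) x z).dist z p := by
    intro q hq
    have := lk_dist_cross hD hq hzp
    rwa [lk_ct hz] at this
  have h0 := hcr x (SimpleGraph.Reachable.refl _)
  rw [SimpleGraph.dist_self] at h0
  have hnew := nn_lk hxy'
  have hlt : nn (lk (ct (red G B) x z) x (v i)) x < nn (red G B) x := by omega
  refine h.T1 hj hji hi hx hy hz ?_ (Or.inr (Or.inr hlt))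
  rintro ⟨ζ', a', b', ha', hb', g1, g2⟩
  refine ⟨?_, hlt⟩
  rcases lk_wit hxy' ha' hb' with ⟨e1, e2⟩ | ⟨q, e1, e2⟩
  · refine ⟨ζ', a', b', e1.mono (ct_le _ _ _), e2.mono (ct_le _ _ _), ?_, by omega⟩
    rw [lk_dist_same hxy' (e1.symm.trans e2), dist_sub h.acyc (ct_le _ _ _) (e1.symm.trans e2)] at g1
    exact g1
  · refine ⟨ζ', q, p, e1.mono (ct_le _ _ _), hp, ?_, by omega⟩
    rw [hcr q e1]
    omega

lemma Opt.C (h : Opt κ d G B t v) {j i : ℕ} (hj : j < t) (hji : j < i) (hi : i < t) {x : V}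
    (hx : (red G B).Reachable (v j) x) (hy : v i ∈ B x)
    {c : ℕ} (hc : nn (red G B) (v i) = c + 1) :
    d + 1 ≤ nn (red G B) (v j) + (κ + 1) * c ∧
      (j = 0 → d + 2 ≤ nn (red G B) (v j) + (κ + 1) * c) := by
  have hxy := h.nreach hj hji hi hx hy
  have hA := h.A hj hji hi hx hy
  rw [nn_eq hx]
  constructor
  · obtain ⟨ζ, a, b, ha, hb, h1, h2⟩ := hA
    have hB := h.Bd hj hji hi hx hy ha hb h1
    rw [nn_lk hxy] at h2
    have : ζ * κ ≤ c * κ := Nat.mul_le_mul_right _ (by omega)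
    nlinarith
  · rintro rfl
    obtain ⟨ζ, a, b, ha, hb, h1, h2⟩ := (bad_congr hx).1 h.legal.bad
    have hB := h.Bd hj hji hi hx hy (ha.mono (le_lk _ _ _)) (hb.mono (le_lk _ _ _)) (by
      rw [lk_dist_same hxy (ha.symm.trans hb)]; exact h1)
    have : ζ * κ ≤ c * κ := Nat.mul_le_mul_right _ (by omega)
    nlinarith

lemma Opt.Dd (h : Opt κ d G B t v) {j i : ℕ} (hj : j < t) (hji : j < i) (hi : i < t) {x : V}
    (hx : (red G B).Reachable (v j) x) (hy : v i ∈ B x)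
    {c e : ℕ} (hc : nn (red G B) (v i) = c + 1) (he : nn (red G B) (v j) = e + 1)
    (hs : (κ + 2) * c < d) : d ≤ (κ + 2) * e := by
  have hxy := h.nreach hj hji hi hx hy
  obtain ⟨ζ, a, b, ha, hb, h1, h2⟩ := h.A hj hji hi hx hy
  have hd := dist_lt_nn ha hb
  rw [nn_eq hx] at he
  rw [nn_lk hxy] at h2 hd
  by_contra hcon
  push Not at hcon
  rcases le_total e c with hec | hec
  · have : ζ * κ ≤ c * κ := Nat.mul_le_mul_right _ (by omega)
    nlinarith
  · have : ζ * κ ≤ e * κ := Nat.mul_le_mul_right _ (by omega)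
    nlinarith

lemma Opt.E1 (h : Opt κ d G B t v) {j i : ℕ} (hj : j < t) (hji : j < i) (hi : i < t) {x : V}
    (hx : (red G B).Reachable (v j) x) (hy : v i ∈ B x)
    {z : V} (hz : (red G B).Adj x z)
    (hn : nn (lk (ct (red G B) x z) x (v i)) x < nn (red G B) x) :
    Bad κ d (lk (ct (red G B) x z) x (v i)) x ∧ ¬ Bad κ d (red G B) x := by
  by_contra hcon
  refine h.T1 hj hji hi hx hy hz ?_ (Or.inr (Or.inr hn))
  intro e
  exact ⟨by tauto, hn⟩

lemma Opt.E1' (h : Opt κ d G B t v) {j i : ℕ} (hj : j < t) (hji : j < i) (hi : i < t) {x : V}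
    (hx : (red G B).Reachable (v j) x) (hy : v i ∈ B x)
    {z : V} (hz : (red G B).Adj x z) (hv : ¬ (ct (red G B) x z).Reachable x (v j)) :
    Bad κ d (lk (ct (red G B) x z) x (v i)) x := by
  by_contra hcon
  refine h.T1 hj hji hi hx hy hz (fun e => absurd e hcon) (Or.inr (Or.inl ?_))
  have := reach_cut hz hx.symm
  tauto

lemma Opt.E2 (h : Opt κ d G B t v) {j i : ℕ} (hj : j < t) (hji : j < i) (hi : i < t) {x : V}
    (hx : (red G B).Reachable (v j) x) (hy : v i ∈ B x)
    {z : V} (hz : (red G B).Adj x z) {c : ℕ} (hc : nn (red G B) (v i) = c + 1)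
    (hb : Bad κ d (lk (ct (red G B) x z) x (v i)) x) :
    d + 1 ≤ nn (ct (red G B) x z) x + (κ + 1) * c := by
  have hxy := h.nreach hj hji hi hx hy
  have hxy' : ¬ (ct (red G B) x z).Reachable x (v i) := fun e => hxy (e.mono (ct_le _ _ _))
  obtain ⟨ζ, a, b, ha, hb, h1, h2⟩ := hb
  have hle := lk_mono (ct_le (red G B) x z) x (v i)
  have hB := h.Bd hj hji hi hx hy (ha.mono hle) (hb.mono hle) (by
    rwa [← dist_sub (acyclic_lk h.acyc hxy) hle (ha.symm.trans hb)])
  rw [nn_lk hxy', nn_cut_other h.acyc hz hxy] at h2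
  have : ζ * κ ≤ c * κ := Nat.mul_le_mul_right _ (by omega)
  nlinarith

lemma Opt.E3 (h : Opt κ d G B t v) {j i : ℕ} (hj : j < t) (hji : j < i) (hi : i < t) {x : V}
    (hx : (red G B).Reachable (v j) x) (hy : v i ∈ B x)
    {z : V} (hz : (red G B).Adj x z) {c : ℕ} (hc : nn (red G B) (v i) = c + 1)
    (hn : nn (lk (ct (red G B) x z) x (v i)) x < nn (red G B) x) :
    ∃ ζ p, (ct (red G B) x z).Reachable x p ∧ 2 * ζ ≤ (red G B).dist x p + c ∧
      d + 1 ≤ nn (ct (red G B) x z) x + c + ζ * κ := by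
  have hxy := h.nreach hj hji hi hx hy
  have hxy' : ¬ (ct (red G B) x z).Reachable x (v i) := fun e => hxy (e.mono (ct_le _ _ _))
  obtain ⟨⟨ζ, a, b, ha, hb, h1, h2⟩, hnb⟩ := h.E1 hj hji hi hx hy hz hn
  rcases lk_wit hxy' ha hb with ⟨e1, e2⟩ | ⟨p, e1, e2⟩
  · exfalso
    apply hnb
    refine ⟨ζ, a, b, e1.mono (ct_le _ _ _), e2.mono (ct_le _ _ _), ?_, by omega⟩
    rwa [lk_dist_same hxy' (e1.symm.trans e2), dist_sub h.acyc (ct_le _ _ _) (e1.symm.trans e2)] at h1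
  · rw [nn_lk hxy', nn_cut_other h.acyc hz hxy] at h2
    rw [nn_cut_other h.acyc hz hxy, dist_sub h.acyc (ct_le _ _ _) e1] at e2
    exact ⟨ζ, p, e1, by omega, by omega⟩

lemma cut_disj {F : SimpleGraph V} (hF : F.IsAcyclic) {x x' z z' : V} (hz : F.Adj x z)
    (hz' : F.Adj x' z') (hzx : (ct F x z).Reachable z x') (hzx' : (ct F x' z').Reachable z' x) (w : V)
    (h1 : (ct F x z).Reachable x w) (h2 : (ct F x' z').Reachable x' w) : False := by
  have e1 := lk_dist_cross (not_reach_ct hF hz) h1 hzx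
  have e2 := lk_dist_cross (not_reach_ct hF hz') h2 hzx'
  rw [lk_ct hz, dist_sub hF (ct_le _ _ _) h1] at e1
  rw [lk_ct hz', dist_sub hF (ct_le _ _ _) h2] at e2
  rw [SimpleGraph.dist_comm] at e1 e2
  omega

lemma cut_sum {F : SimpleGraph V} (hF : F.IsAcyclic) {x x' z z' : V} (hz : F.Adj x z)
    (hz' : F.Adj x' z') (hzx : (ct F x z).Reachable z x') (hzx' : (ct F x' z').Reachable z' x) :
    nn (ct F x z) x + nn (ct F x' z') x' ≤ nn F x := by
  rw [nn, nn, ← Finset.card_union_of_disjoint]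
  · apply Finset.card_le_card
    intro w
    rw [Finset.mem_union, mem_comp, mem_comp, mem_comp]
    rintro (h | h)
    · exact h.mono (ct_le _ _ _)
    · exact (hz.reachable.trans (hzx.mono (ct_le _ _ _))).trans (h.mono (ct_le _ _ _))
  · rw [Finset.disjoint_left]
    intro w h1 h2
    rw [mem_comp] at h1 h2
    exact cut_disj hF hz hz' hzx hzx' w h1 h2

lemma cut_dist {F : SimpleGraph V} (hF : F.IsAcyclic) {x x' z z' : V} (hz : F.Adj x z)
    (hz' : F.Adj x' z') (hzx : (ct F x z).Reachable z x') (hzx' : (ct F x' z').Reachable z' x) {p p' : V}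
    (h1 : (ct F x z).Reachable x p) (h2 : (ct F x' z').Reachable x' p') :
    F.dist x p + F.dist x' p' + 1 ≤ F.dist p p' := by
  have hxx' : F.Reachable x x' := hz.reachable.trans (hzx.mono (ct_le _ _ _))
  have hzp' : (ct F x z).Reachable z p' := by
    rcases reach_cut hz (hxx'.trans (h2.mono (ct_le _ _ _))) with e | e
    · exact (cut_disj hF hz hz' hzx hzx' p' e h2).elim
    · exact e
  have e1 := lk_dist_cross (not_reach_ct hF hz) h1 hzp'
  have e2 := lk_dist_cross (not_reach_ct hF hz) (SimpleGraph.Reachable.refl x) hzp'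
  have e3 := lk_dist_cross (not_reach_ct hF hz') h2 hzx'
  rw [lk_ct hz, dist_sub hF (ct_le _ _ _) h1] at e1
  rw [lk_ct hz, SimpleGraph.dist_self] at e2
  rw [lk_ct hz', dist_sub hF (ct_le _ _ _) h2, SimpleGraph.dist_comm] at e3
  omega

/-- all small children of `j` hang at the same vertex -/
lemma Opt.E (h : Opt κ d G B t v) {j i i' : ℕ} (hj : j < t) (hji : j < i) (hi : i < t)
    (hji' : j < i') (hi' : i' < t) {x x' : V}
    (hx : (red G B).Reachable (v j) x) (hy : v i ∈ B x)
    (hx' : (red G B).Reachable (v j) x') (hy' : v i' ∈ B x') {c c' : ℕ}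
    (hc : nn (red G B) (v i) = c + 1) (hc' : nn (red G B) (v i') = c' + 1)
    (hs : (κ + 2) * c < d) (hs' : (κ + 2) * c' < d) : x = x' := by
  by_contra hne
  obtain ⟨z, hz, hzx⟩ := exists_toward (hx.symm.trans hx') hne
  obtain ⟨z', hz', hzx'⟩ := exists_toward (hx'.symm.trans hx) (Ne.symm hne)
  have hA := h.acyc
  have hsum := cut_sum hA hz hz' hzx hzx'
  have hxy := h.nreach hj hji hi hx hy
  have hxy' := h.nreach hj hji' hi' hx' hy'
  have n1 : nn (lk (ct (red G B) x z) x (v i)) x = nn (ct (red G B) x z) x + (c + 1) := by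
    rw [nn_lk (fun e => hxy (e.mono (ct_le _ _ _))), nn_cut_other hA hz hxy, hc]
  have n2 : nn (lk (ct (red G B) x' z') x' (v i')) x' = nn (ct (red G B) x' z') x' + (c' + 1) := by
    rw [nn_lk (fun e => hxy' (e.mono (ct_le _ _ _))), nn_cut_other hA hz' hxy', hc']
  have nx : nn (red G B) x = nn (red G B) x' := nn_eq (hx.symm.trans hx')
  have big1 : Bad κ d (lk (ct (red G B) x z) x (v i)) x → c' + 2 ≤ nn (ct (red G B) x z) x := by
    intro e
    have := h.E2 hj hji hi hx hy hz hc e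
    rcases le_total c c' with q | q
    · have : (κ + 1) * c ≤ (κ + 1) * c' := Nat.mul_le_mul_left _ q
      nlinarith
    · nlinarith
  have big2 : Bad κ d (lk (ct (red G B) x' z') x' (v i')) x' → c + 2 ≤ nn (ct (red G B) x' z') x' := by
    intro e
    have := h.E2 hj hji' hi' hx' hy' hz' hc' e
    rcases le_total c' c with q | q
    · have : (κ + 1) * c' ≤ (κ + 1) * c := Nat.mul_le_mul_left _ q
      nlinarith
    · nlinarith
  have step1 : Bad κ d (lk (ct (red G B) x z) x (v i)) x → nn (lk (ct (red G B) x' z') x' (v i')) x' < nn (red G B) x' := by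
    intro e; have := big1 e; omega
  have step2 : Bad κ d (lk (ct (red G B) x' z') x' (v i')) x' → nn (lk (ct (red G B) x z) x (v i)) x < nn (red G B) x := by
    intro e; have := big2 e; omega
  have both : nn (lk (ct (red G B) x z) x (v i)) x < nn (red G B) x ∧ nn (lk (ct (red G B) x' z') x' (v i')) x' < nn (red G B) x' := by
    by_cases hv : (ct (red G B) x z).Reachable x (v j)
    · have hv' : ¬ (ct (red G B) x' z').Reachable x' (v j) := fun e =>
        cut_disj hA hz hz' hzx hzx' (v j) hv e
      have b2 := h.E1' hj hji' hi' hx' hy' hz' hv'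
      have s2 := step2 b2
      exact ⟨s2, step1 (h.E1 hj hji hi hx hy hz s2).1⟩
    · have b1 := h.E1' hj hji hi hx hy hz hv
      have s1 := step1 b1
      exact ⟨step2 (h.E1 hj hji' hi' hx' hy' hz' s1).1, s1⟩
  have hnb := (h.E1 hj hji hi hx hy hz both.1).2
  obtain ⟨ζ, p, p1, p2, p3⟩ := h.E3 hj hji hi hx hy hz hc both.1
  obtain ⟨ζ', p', p1', p2', p3'⟩ := h.E3 hj hji' hi' hx' hy' hz' hc' both.2
  have hδ := cut_dist hA hz hz' hzx hzx' p1 p1'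
  obtain ⟨η, hη1, hη2⟩ : ∃ η, 2 * η + 1 ≤ (red G B).dist p p' ∧ (red G B).dist p p' ≤ 2 * η + 2 :=
    ⟨((red G B).dist p p' - 1) / 2, by omega, by omega⟩
  have hK : nn (red G B) x + η * κ ≤ d + 1 := by
    by_contra hcon
    apply hnb
    exact ⟨η, p, p', p1.mono (ct_le _ _ _),
      (hx.symm.trans hx').trans (p1'.mono (ct_le _ _ _)), hη1, by omega⟩
  rcases le_total c c' with q | q
  · have h1 : ζ + ζ' ≤ c' + η := by omega
    have := Nat.mul_le_mul_right κ h1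
    nlinarith
  · have h1 : ζ + ζ' ≤ c + η := by omega
    have := Nat.mul_le_mul_right κ h1
    nlinarith

end opt


/-- edges of `G` inside `U` -/
def iE (G : SimpleGraph V) (U : Finset V) : Set (Sym2 V) := {e | e ∈ G.edgeSet ∧ ∀ w ∈ e, w ∈ U}

lemma count_blue {G : SimpleGraph V} {B : V → Finset V} (hB : Pre G B) {U : Finset V} {k : ℕ}
    (hd : ∀ u ∈ U, (B u).card = k) (hc : ∀ u ∈ U, ∀ w ∈ B u, w ∈ U) :
    k * U.card + (iE (red G B) U).ncard ≤ (iE G U).ncard := by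
  let S : Finset (Σ _ : V, V) := U.sigma B
  let f : (Σ _ : V, V) → Sym2 V := fun p => s(p.1, p.2)
  have hinj : Set.InjOn f (S : Set (Σ _ : V, V)) := by
    rintro ⟨a, b⟩ h1 ⟨a', b'⟩ h2 h3
    simp only [S, Finset.mem_coe, Finset.mem_sigma] at h1 h2
    simp only [f, Sym2.eq, Sym2.rel_iff', Prod.mk.injEq, Prod.swap_prod_mk] at h3
    rcases h3 with ⟨rfl, rfl⟩ | ⟨rfl, rfl⟩
    · rfl
    · exact absurd h1.2 (hB.asym _ _ h2.2)
  have hcard : S.card = k * U.card := by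
    rw [Finset.card_sigma, Finset.sum_congr rfl hd, Finset.sum_const, smul_eq_mul, mul_comm]
  have h1 : (f '' (S : Set (Σ _ : V, V))).ncard = k * U.card := by
    rw [Set.ncard_image_of_injOn hinj, Set.ncard_coe_finset, hcard]
  have hdis : Disjoint (f '' (S : Set (Σ _ : V, V))) (iE (red G B) U) := by
    rw [Set.disjoint_left]
    rintro _ ⟨⟨a, b⟩, h1, rfl⟩ h2
    simp only [S, Finset.mem_coe, Finset.mem_sigma] at h1
    exact h2.1.2.1 h1.2
  rw [← h1, ← Set.ncard_union_eq hdis (Set.toFinite _) (Set.toFinite _)]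
  apply Set.ncard_le_ncard _ (Set.toFinite _)
  rintro e (⟨⟨a, b⟩, h2, rfl⟩ | h2)
  · simp only [S, Finset.mem_coe, Finset.mem_sigma] at h2
    refine ⟨hB.adj _ _ h2.2, ?_⟩
    intro w hw
    simp only [f, Sym2.mem_iff] at hw
    rcases hw with rfl | rfl
    · exact h2.1
    · exact hc _ h2.1 _ h2.2
  · refine ⟨?_, h2.2⟩
    have := h2.1
    induction e with
    | h a b => exact this.1

lemma exists_closer {F : SimpleGraph V} {u r : V} (h : F.Reachable u r) (hne : u ≠ r) :
    ∃ z, F.Adj u z ∧ F.dist z r < F.dist u r := by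
  obtain ⟨q, hq⟩ := h.exists_walk_length_eq_dist
  cases q with
  | nil => exact absurd rfl hne
  | cons hadj q =>
    rename_i z
    refine ⟨z, hadj, ?_⟩
    rw [← hq, SimpleGraph.Walk.length_cons]
    have := SimpleGraph.dist_le q
    omega

lemma count_red {F : SimpleGraph V} {t : ℕ} {v : ℕ → V}
    (hdis : ∀ i j, i < t → j < t → F.Reachable (v i) (v j) → i = j) {U : Finset V}
    (hU : ∀ u, u ∈ U ↔ ∃ j < t, F.Reachable (v j) u) :
    U.card ≤ t + (iE F U).ncard := by
  let R : Finset V := (Finset.range t).image v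
  have hR : R.card ≤ t := by
    have := Finset.card_image_le (s := Finset.range t) (f := v)
    simpa using this
  have hch : ∀ u, ∃ j z, u ∈ U \ R → j < t ∧ F.Reachable (v j) u ∧ F.Adj u z ∧
      F.dist z (v j) < F.dist u (v j) := by
    intro u
    by_cases hu : u ∈ U \ R
    · rw [Finset.mem_sdiff, hU] at hu
      obtain ⟨⟨j, hj, hr⟩, h2⟩ := hu
      have hne : u ≠ v j := by
        rintro rfl
        exact h2 (Finset.mem_image_of_mem _ (Finset.mem_range.2 hj))
      obtain ⟨z, h3, h4⟩ := exists_closer hr.symm hne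
      exact ⟨j, z, fun _ => ⟨hj, hr, h3, h4⟩⟩
    · exact ⟨0, u, fun h => absurd h hu⟩
  choose J Z hJ using hch
  have h1 : ((U \ R : Finset V) : Set V).ncard ≤ (iE F U).ncard := by
    apply Set.ncard_le_ncard_of_injOn (fun u => s(u, Z u)) _ _ (Set.toFinite _)
    · intro u hu
      obtain ⟨a1, a2, a3, a4⟩ := hJ u (by simpa using hu)
      refine ⟨a3, ?_⟩
      intro w hw
      rw [Sym2.mem_iff] at hw
      rw [hU]
      rcases hw with rfl | rfl
      · exact ⟨_, a1, a2⟩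
      · exact ⟨_, a1, a2.trans a3.reachable⟩
    · intro u hu w hw huw
      obtain ⟨a1, a2, a3, a4⟩ := hJ u (by simpa using hu)
      obtain ⟨b1, b2, b3, b4⟩ := hJ w (by simpa using hw)
      simp only [Sym2.eq, Sym2.rel_iff', Prod.mk.injEq, Prod.swap_prod_mk] at huw
      rcases huw with ⟨rfl, _⟩ | ⟨e1, e2⟩
      · rfl
      · rw [e2] at a3 a4
        have : J u = J w := hdis _ _ a1 b1 ((a2.trans a3.reachable).trans b2.symm)
        rw [← e1, ← this] at b4
        omega
  rw [Set.ncard_coe_finset] at h1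
  have h2 := Finset.le_card_sdiff R U
  omega

lemma arith1 {T : Finset ℕ} {W : ℕ → ℤ} {m : ℕ} (hm : 0 < m) {W0 : ℤ} (hT : T.card ≤ m)
    (h0 : 0 ≤ W0) (h : ∀ i ∈ T, - W0 ≤ m * W i) : 0 ≤ W0 + ∑ i ∈ T, W i := by
  have h1 := Finset.card_nsmul_le_sum T _ _ h
  rw [← Finset.mul_sum, nsmul_eq_mul] at h1
  have h2 : (T.card : ℤ) ≤ m := by exact_mod_cast hT
  have h3 : (0 : ℤ) < m := by exact_mod_cast hm
  have h4 : 0 ≤ (m : ℤ) * (W0 + ∑ i ∈ T, W i) := by nlinarith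
  exact nonneg_of_mul_nonneg_right h4 h3

lemma arith2 {T : Finset ℕ} {W : ℕ → ℤ} {m : ℕ} (hm : 0 < m) {W0 : ℤ} (hT : T.card ≤ m)
    (h0 : 0 < W0) (h : ∀ i ∈ T, - W0 < m * W i) : 0 < W0 + ∑ i ∈ T, W i := by
  have h1 := Finset.card_nsmul_le_sum T (fun i => (m : ℤ) * W i) (1 - W0) (fun i hi => by have := h i hi; linarith)
  rw [← Finset.mul_sum, nsmul_eq_mul] at h1
  have h2 : (T.card : ℤ) ≤ m := by exact_mod_cast hT
  have h3 : (0 : ℤ) < m := by exact_mod_cast hm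
  have h5 : (0 : ℤ) ≤ T.card := by positivity
  have h4 : 0 < (m : ℤ) * (W0 + ∑ i ∈ T, W i) := by
    rcases h5.eq_or_lt with e | e
    · rw [← e] at h1; nlinarith
    · nlinarith
  exact (pos_iff_pos_of_mul_pos h4).1 h3

lemma Opt.false {κ d : ℕ} {G : SimpleGraph V} {B : V → Finset V} {t : ℕ} {v : ℕ → V}
    (h : Opt κ d G B t v)
    (hm : ∀ U : Finset V, U.Nonempty →
      (d + κ + 2) * (iE G U).ncard ≤ (κ + 2) * (d + κ + 1) * U.card) : False := by
  set F := red G B with hF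
  let W : ℕ → ℤ := fun j => (κ + 2) * (nn F (v j)) - (d + κ + 2)
  -- upper bound
  have hup : ∑ j ∈ Finset.range t, W j ≤ 0 := by
    let U : Finset V := univ.filter (fun u => ∃ j < t, F.Reachable (v j) u)
    have hU : ∀ u, u ∈ U ↔ ∃ j < t, F.Reachable (v j) u := by intro u; simp [U]
    have hne : U.Nonempty := ⟨v 0, (hU _).2 ⟨0, h.legal.pos, SimpleGraph.Reachable.refl _⟩⟩
    have h1 := hm U hne
    have h2 := count_red (F := F) (t := t) (v := v) (fun i j hi hj hr => h.legal.dis' hi hj hr) hU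
    have h3 := count_blue (U := U) (k := κ + 1) h.valid.toPre (by
      intro u hu
      obtain ⟨j, hj, hr⟩ := (hU u).1 hu
      exact h.deg hj hr) (by
      intro u hu w hw
      obtain ⟨j, hj, hr⟩ := (hU u).1 hu
      exact (hU w).2 (h.closed hj hr hw))
    have h4 : U.card = ∑ j ∈ Finset.range t, nn F (v j) := by
      have : U = (Finset.range t).biUnion (fun j => comp F (v j)) := by
        ext u
        simp only [hU, Finset.mem_biUnion, Finset.mem_range, mem_comp]
      rw [this, Finset.card_biUnion]
      · rfl
      · intro i hi j hj hij
        apply disj_comp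
        intro e
        exact hij (h.legal.dis' (Finset.mem_range.1 hi) (Finset.mem_range.1 hj) e)
    have h5 : ∑ j ∈ Finset.range t, W j = (κ + 2) * (U.card : ℤ) - t * (d + κ + 2) := by
      simp only [W]
      rw [Finset.sum_sub_distrib, ← Finset.mul_sum, h4]
      simp
    rw [h5]
    have h6 : (κ + 2) * U.card ≤ t + (iE G U).ncard := by rw [← hF] at h3; nlinarith
    have h7 : (d + κ + 2) * ((κ + 2) * U.card) ≤ (d + κ + 2) * (t + (iE G U).ncard) :=
      Nat.mul_le_mul_left _ h6
    have h8 : (κ + 2) * U.card ≤ t * (d + κ + 2) := by nlinarith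
    have h9 : ((κ : ℤ) + 2) * (U.card : ℤ) ≤ t * (d + κ + 2) := by exact_mod_cast h8
    linarith
  -- parents
  have hpar : ∀ i, ∃ j x, 0 < i → i < t → j < i ∧ F.Reachable (v j) x ∧ v i ∈ B x := by
    intro i
    by_cases hi : 0 < i ∧ i < t
    · obtain ⟨j, hj, x, h1, h2⟩ := h.legal.arc i hi.2 hi.1
      exact ⟨j, x, fun _ _ => ⟨hj, h1, h2⟩⟩
    · exact ⟨0, v 0, fun a b => absurd ⟨a, b⟩ hi⟩
  choose par X hpar using hpar
  have hW0 : 0 < W 0 := by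
    obtain ⟨ζ, a, b, ha, hb, h1, h2⟩ := h.legal.bad
    have h3 := dist_lt_nn ha hb
    rw [← hF] at h1 h2 h3
    have h4 : d + κ + 3 ≤ (κ + 2) * nn F (v 0) := by nlinarith
    have h5 : (d : ℤ) + κ + 3 ≤ (κ + 2) * nn F (v 0) := by exact_mod_cast h4
    simp only [W]
    linarith
  let S : Finset ℕ := (Finset.range t).filter (fun i => W i < 0)
  let N : Finset ℕ := (Finset.range t).filter (fun i => ¬ W i < 0)
  have hS : ∀ i ∈ S, i < t ∧ 0 < i ∧ W i < 0 := by
    intro i hi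
    simp only [S, Finset.mem_filter, Finset.mem_range] at hi
    refine ⟨hi.1, ?_, hi.2⟩
    rcases Nat.eq_zero_or_pos i with rfl | h0
    · exact absurd hi.2 (by omega)
    · exact h0
  have hcs : ∀ i, W i < 0 → ∃ c, nn F (v i) = c + 1 ∧ (κ + 2) * c < d ∧
      W i = (κ + 2) * (c : ℤ) - d := by
    intro i hi
    obtain ⟨c, hc⟩ : ∃ c, nn F (v i) = c + 1 := ⟨nn F (v i) - 1, by have := nn_pos F (v i); omega⟩
    have e : W i = (κ + 2) * (c : ℤ) - d := by
      simp only [W, hc]; push_cast; ring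
    refine ⟨c, hc, ?_, e⟩
    have : ((κ + 2) * c : ℤ) < d := by linarith
    exact_mod_cast this
  have hmaps : ∀ i ∈ S, par i ∈ N := by
    intro i hi
    obtain ⟨h1, h2, h3⟩ := hS i hi
    obtain ⟨p1, p2, p3⟩ := hpar i h2 h1
    simp only [N, Finset.mem_filter, Finset.mem_range]
    refine ⟨by omega, ?_⟩
    intro h4
    obtain ⟨c, c1, c2, c3⟩ := hcs i h3
    obtain ⟨e, e1, e2, e3⟩ := hcs _ h4
    have := h.Dd (by omega) p1 h1 p2 p3 c1 e1 c2
    omega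
  have hsplit : ∑ j ∈ Finset.range t, W j = ∑ j ∈ N, (W j + ∑ i ∈ S with par i = j, W i) := by
    rw [Finset.sum_add_distrib, Finset.sum_fiberwise_of_maps_to hmaps,
      ← Finset.sum_filter_add_sum_filter_not (Finset.range t) (fun i => W i < 0), add_comm]
  have hT : ∀ j, (S.filter (fun i => par i = j)).card ≤ κ + 1 := by
    intro j
    rcases (S.filter (fun i => par i = j)).eq_empty_or_nonempty with e | ⟨i0, hi0⟩
    · rw [e]; simp
    · rw [Finset.mem_filter] at hi0
      obtain ⟨h1, h2, h3⟩ := hS i0 hi0.1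
      obtain ⟨p1, p2, p3⟩ := hpar i0 h2 h1
      obtain ⟨c, c1, c2, c3⟩ := hcs i0 h3
      refine le_trans ?_ (h.valid.deg (X i0))
      apply Finset.card_le_card_of_injOn v
      · intro i hi
        rw [Finset.mem_coe, Finset.mem_filter] at hi
        obtain ⟨h1', h2', h3'⟩ := hS i hi.1
        obtain ⟨p1', p2', p3'⟩ := hpar i h2' h1'
        obtain ⟨c', c1', c2', c3'⟩ := hcs i h3'
        rw [hi.2] at p1' p2'
        rw [hi0.2] at p1 p2
        have : X i0 = X i := h.E (by omega) p1 h1 p1' h1' p2 p3 p2' p3' c1 c1' c2 c2'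
        rw [this]; exact p3'
      · intro i hi i' hi' hii
        rw [Finset.mem_coe, Finset.mem_filter] at hi hi'
        apply h.legal.dis' (hS i hi.1).1 (hS i' hi'.1).1
        rw [hii]
  have hchild : ∀ j, ∀ i ∈ S.filter (fun i => par i = j), - W j ≤ ((κ + 1 : ℕ) : ℤ) * W i ∧
      (j = 0 → - W j < ((κ + 1 : ℕ) : ℤ) * W i) := by
    intro j i hi
    rw [Finset.mem_filter] at hi
    obtain ⟨h1, h2, h3⟩ := hS i hi.1
    obtain ⟨p1, p2, p3⟩ := hpar i h2 h1
    obtain ⟨c, c1, c2, c3⟩ := hcs i h3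
    rw [hi.2] at p1 p2
    obtain ⟨q1, q2⟩ := h.C (by omega) p1 h1 p2 p3 c1
    rw [← hF] at q1 q2
    rw [c3]
    simp only [W]
    constructor
    · have : (d : ℤ) + 1 ≤ nn F (v j) + (κ + 1) * c := by exact_mod_cast q1
      push_cast
      nlinarith
    · intro e
      have : (d : ℤ) + 2 ≤ nn F (v j) + (κ + 1) * c := by exact_mod_cast q2 e
      push_cast
      nlinarith
  have hpos : 0 < ∑ j ∈ N, (W j + ∑ i ∈ S with par i = j, W i) := by
    apply Finset.sum_pos'
    · intro j hj
      simp only [N, Finset.mem_filter, Finset.mem_range] at hj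
      exact arith1 (m := κ + 1) (by omega) (hT j) (by omega) (fun i hi => (hchild j i hi).1)
    · refine ⟨0, ?_, ?_⟩
      · simp only [N, Finset.mem_filter, Finset.mem_range]
        exact ⟨h.legal.pos, by omega⟩
      · exact arith2 (m := κ + 1) (by omega) (hT 0) hW0 (fun i hi => (hchild 0 i hi).2 rfl)
  omega

lemma exists_min {α β : Type*} [LT β] [WellFoundedLT β] (P : α → Prop) (h : ∃ a, P a) (f : α → β) :
    ∃ a, P a ∧ ∀ b, P b → ¬ f b < f a := by
  obtain ⟨a, h1, h2⟩ := (InvImage.wf f (wellFounded_lt (α := β))).has_min {a | P a} h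
  exact ⟨a, h1, h2⟩

lemma exists_opt {κ d : ℕ} {G : SimpleGraph V} {B0 : V → Finset V} (hV : Valid G (κ + 1) B0)
    (hA : (red G B0).IsAcyclic)
    (hmin : ∀ B', Valid G (κ + 1) B' → (red G B0).edgeSet.ncard ≤ (red G B').edgeSet.ncard)
    (hbad : ∀ B, Valid G (κ + 1) B → (red G B).IsAcyclic → ∃ w, Bad κ d (red G B) w) :
    ∃ B t v, Opt κ d G B t v := by
  let P : (V → Finset V) → Prop := fun B => Valid G (κ + 1) B ∧ (red G B).IsAcyclic ∧
    (red G B).edgeSet.ncard ≤ (red G B0).edgeSet.ncard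
  obtain ⟨B1, hB1, hB1m⟩ := exists_min P ⟨B0, hV, hA, le_rfl⟩ (fun B => Phi κ d (red G B))
  let Q : (V → Finset V) × ℕ × (ℕ → V) → Prop := fun q => P q.1 ∧
    Phi κ d (red G q.1) ≤ Phi κ d (red G B1) ∧ Legal κ d G q.1 q.2.1 q.2.2
  have hQ : ∃ q, Q q := by
    obtain ⟨w, hw⟩ := hbad B1 hB1.1 hB1.2.1
    have hl : Legal κ d G B1 1 (fun _ => w) :=
      ⟨by omega, hw, by intro j h1 h2; omega, by intro i j h1 h2; omega⟩
    exact ⟨(B1, 1, fun _ => w), hB1, le_rfl, hl⟩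
  obtain ⟨⟨B, t, v⟩, ⟨hP, hPhi, hL⟩, hm⟩ := exists_min Q hQ (fun q =>
    toLex (fun i : Fin (Fintype.card V) => val (red G q.1) q.2.1 q.2.2 i))
  dsimp only at hP hPhi hL
  refine ⟨B, t, v, hP.1, hP.2.1, ?_, hL, ?_, ?_⟩
  · intro B' hB'
    exact hP.2.2.trans (hmin B' hB')
  · intro B' h1 h2 h3
    have := hB1m B' ⟨h1, h2, h3.trans hP.2.2⟩
    omega
  · intro B' h1 h2 h3 h4 t' v' h5 j hj h6
    by_contra hcon
    apply hm (B', t', v') ⟨⟨h1, h2, h3.trans hP.2.2⟩, h4.trans hPhi, h5⟩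
    refine ⟨⟨j, hj⟩, ?_, ?_⟩
    · intro i hi
      exact h6 i hi
    · exact not_le.1 hcon


/-- number of components -/
noncomputable def cc (F : SimpleGraph V) : ℕ := (univ.image (comp F)).card

lemma cc_lk {D : SimpleGraph V} {x y : V} (hxy : ¬ D.Reachable x y) : cc (lk D x y) + 1 = cc D := by
  have hne : x ≠ y := fun h => hxy (h ▸ SimpleGraph.Reachable.refl _)
  let R : Finset (Finset V) := (univ.filter (fun w => ¬ D.Reachable x w ∧ ¬ D.Reachable y w)).image (comp D)
  have hR : ∀ s ∈ R, x ∉ s ∧ y ∉ s := by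
    intro s hs
    simp only [R, Finset.mem_image, Finset.mem_filter, Finset.mem_univ, true_and] at hs
    obtain ⟨w, ⟨h1, h2⟩, rfl⟩ := hs
    rw [mem_comp, mem_comp]
    exact ⟨fun h => h1 h.symm, fun h => h2 h.symm⟩
  have hxx : x ∈ comp D x := mem_comp.2 (SimpleGraph.Reachable.refl _)
  have hyy : y ∈ comp D y := mem_comp.2 (SimpleGraph.Reachable.refl _)
  have e1 : univ.image (comp D) = insert (comp D x) (insert (comp D y) R) := by
    ext s
    simp only [R, Finset.mem_image, Finset.mem_insert, Finset.mem_filter, Finset.mem_univ, true_and]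
    constructor
    · rintro ⟨w, rfl⟩
      by_cases h1 : D.Reachable x w
      · left; exact (comp_eq h1).symm
      · by_cases h2 : D.Reachable y w
        · right; left; exact (comp_eq h2).symm
        · right; right; exact ⟨w, ⟨h1, h2⟩, rfl⟩
    · rintro (rfl | rfl | ⟨w, _, rfl⟩)
      · exact ⟨x, rfl⟩
      · exact ⟨y, rfl⟩
      · exact ⟨w, rfl⟩
  have e2 : univ.image (comp (lk D x y)) = insert (comp D x ∪ comp D y) R := by
    ext s
    simp only [R, Finset.mem_image, Finset.mem_insert, Finset.mem_filter, Finset.mem_univ, true_and]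
    constructor
    · rintro ⟨w, rfl⟩
      by_cases h1 : (lk D x y).Reachable x w
      · left; rw [← comp_eq h1, comp_lk hxy]
      · right
        have h2 : ¬ D.Reachable x w := fun h => h1 (h.mono (le_lk _ _ _))
        have h3 : ¬ D.Reachable y w := fun h =>
          h1 ((lk_adj_self hne).reachable.trans (h.mono (le_lk _ _ _)))
        exact ⟨w, ⟨h2, h3⟩, (comp_lk_other hxy h2 h3).symm⟩
    · rintro (rfl | ⟨w, ⟨h1, h2⟩, rfl⟩)
      · exact ⟨x, comp_lk hxy⟩
      · exact ⟨w, comp_lk_other hxy h1 h2⟩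
  have hn1 : comp D y ∉ R := fun h => (hR _ h).2 hyy
  have hn2 : comp D x ∉ insert (comp D y) R := by
    rw [Finset.mem_insert]
    rintro (h | h)
    · rw [← h, mem_comp] at hyy
      exact hxy hyy
    · exact (hR _ h).1 hxx
  have hn3 : comp D x ∪ comp D y ∉ R := fun h => (hR _ h).1 (Finset.mem_union_left _ hxx)
  rw [cc, cc, e1, e2, Finset.card_insert_of_notMem hn2, Finset.card_insert_of_notMem hn1,
    Finset.card_insert_of_notMem hn3]

lemma reach_nonbridge {F : SimpleGraph V} {x z : V} (hz : F.Adj x z)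
    (h : (ct F x z).Reachable x z) (a b : V) : F.Reachable a b ↔ (ct F x z).Reachable a b := by
  constructor
  · intro hab
    rw [← lk_ct hz, lk_reach hz.ne] at hab
    rcases hab with h1 | ⟨h1, h2⟩ | ⟨h1, h2⟩
    · exact h1
    · exact (h1.trans h).trans h2
    · exact (h1.trans h.symm).trans h2
  · intro hab
    exact hab.mono (ct_le _ _ _)

lemma ct_mono {D F : SimpleGraph V} (h : D ≤ F) (x z : V) : ct D x z ≤ ct F x z := by
  intro a b
  rw [ct_adj, ct_adj]
  exact fun e => ⟨h e.1, e.2⟩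

lemma ct_le_lk_ct_ct (F : SimpleGraph V) {w z : V} (hz : w ≠ z) (u z0 : V) :
    ct F u z0 ≤ lk (ct (ct F w z) u z0) w z := by
  intro a b
  rw [ct_adj, lk_adj, ct_adj, ct_adj]
  grind

set_option maxHeartbeats 1000000 in
lemma exists_acyclic {k : ℕ} {G : SimpleGraph V}
    (hm : ∀ U : Finset V, U.Nonempty → (iE G U).ncard < (k + 1) * U.card) :
    ∃ B, Valid G k B ∧ (red G B).IsAcyclic ∧
      ∀ B', Valid G k B' → (red G B).edgeSet.ncard ≤ (red G B').edgeSet.ncard := by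
  obtain ⟨Bm, hBm, hBmin⟩ := exists_min (Valid G k)
    ⟨fun _ => ∅, ⟨⟨by simp, by simp⟩, by simp⟩⟩ (fun B => (red G B).edgeSet.ncard)
  obtain ⟨B0, ⟨hB0, hB0e⟩, hB0c⟩ := exists_min (fun B => Valid G k B ∧
    (red G B).edgeSet.ncard ≤ (red G Bm).edgeSet.ncard) ⟨Bm, hBm, le_rfl⟩ (fun B => cc (red G B))
  by_contra hcon
  have hna : ¬ (red G B0).IsAcyclic := by
    intro hA
    apply hcon
    refine ⟨B0, hB0, hA, ?_⟩
    intro B' hB'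
    have := hBmin B' hB'
    omega
  let Q : (V → Finset V) × V → Prop := fun q => Valid G k q.1 ∧
    (red G q.1).edgeSet.ncard ≤ (red G Bm).edgeSet.ncard ∧ cc (red G q.1) ≤ cc (red G B0) ∧
    ∃ z, (red G q.1).Adj q.2 z ∧ (ct (red G q.1) q.2 z).Reachable q.2 z
  have hQ : ∃ q, Q q := by
    rw [SimpleGraph.isAcyclic_iff_forall_adj_isBridge] at hna
    push Not at hna
    obtain ⟨u, z, h1, h2⟩ := hna
    rw [SimpleGraph.isBridge_iff] at h2
    refine ⟨(B0, u), hB0, hB0e, le_rfl, z, h1, ?_⟩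
    by_contra h3
    exact h2 h3
  obtain ⟨⟨B, u⟩, ⟨hV, hE, hC, z0, hz0, hnb⟩, hmin⟩ := exists_min Q hQ (fun q => nn (red G q.1) q.2)
  dsimp only at hV hE hC hz0 hnb
  have hminE : ∀ B', Valid G k B' → (red G B).edgeSet.ncard ≤ (red G B').edgeSet.ncard := by
    intro B' hB'
    have := hBmin B' hB'
    omega
  have hminC : ∀ B', Valid G k B' → (red G B').edgeSet.ncard ≤ (red G B).edgeSet.ncard →
      cc (red G B) ≤ cc (red G B') := by
    intro B' h1 h2
    have := hB0c B' ⟨h1, h2.trans hE⟩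
    omega
  have hnbr : ∀ w, (red G B).Reachable u w → ∃ z, (red G B).Adj w z ∧
      ((ct (red G B) w z).Reachable w z ∨ (ct (red G B) w z).Reachable z u) := by
    intro w hw
    by_cases e : w = u
    · subst e; exact ⟨z0, hz0, Or.inl hnb⟩
    · obtain ⟨z, h1, h2⟩ := exists_toward hw.symm e
      exact ⟨z, h1, Or.inr h2⟩
  have hdeg : ∀ w, (red G B).Reachable u w → (B w).card = k := by
    intro w hw
    obtain ⟨z, hz, _⟩ := hnbr w hw
    have hle := hV.deg w
    by_contra hne
    obtain ⟨B', h1, h2⟩ := reduce hV.toPre (k := k) hz (by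
      intro a
      have := hV.deg a
      split_ifs with e
      · rw [e]; omega
      · omega)
    have := hminE B' h1
    omega
  have hclosed : ∀ w, (red G B).Reachable u w → ∀ y ∈ B w, (red G B).Reachable u y := by
    intro w hw y hy
    by_contra huy
    have hwy : ¬ (red G B).Reachable w y := fun e => huy (hw.trans e)
    obtain ⟨z, hz, hor⟩ := hnbr w hw
    have hwy' : ¬ (ct (red G B) w z).Reachable w y := fun e => hwy (e.mono (ct_le _ _ _))
    obtain ⟨B', g1, g2, g3⟩ := swap (k := k) hV.toPre hy hz (by
      intro a; have := hV.deg a; omega)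
    have gE : (red G B').edgeSet.ncard ≤ (red G B).edgeSet.ncard := by
      rw [g2]; exact edges_swap hz
    have gC := hminC B' g1 gE
    have c1 := cc_lk hwy'
    rw [← g2] at c1
    by_cases hbr : (ct (red G B) w z).Reachable w z
    · have : cc (ct (red G B) w z) = cc (red G B) := by
        rw [cc, cc]
        congr 2
        ext a b
        rw [mem_comp, mem_comp]
        exact (reach_nonbridge hz hbr a b).symm
      omega
    · have hzu : (ct (red G B) w z).Reachable z u := by tauto
      have c2 := cc_lk hbr
      rw [lk_ct hz] at c2
      have hed : s(u, z0) ≠ s(w, z) := by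
        intro e
        rw [Sym2.eq_iff] at e
        rcases e with ⟨rfl, rfl⟩ | ⟨rfl, rfl⟩
        · exact hbr hnb
        · rw [ct_comm] at hnb; exact hbr hnb.symm
      have hadjD : (ct (red G B) w z).Adj u z0 := by
        rw [ct_adj]
        refine ⟨hz0, ?_⟩
        simpa [Sym2.eq_iff] using hed
      have hnbD : (ct (ct (red G B) w z) u z0).Reachable u z0 := by
        have hle : ct (red G B) u z0 ≤ lk (ct (ct (red G B) w z) u z0) w z := by
          exact ct_le_lk_ct_ct _ hz.ne _ _
        have h1 := hnb.mono hle
        rw [lk_reach hz.ne] at h1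
        have hD := ct_le (ct (red G B) w z) u z0
        rcases h1 with h1 | ⟨h1, h2⟩ | ⟨h1, h2⟩
        · exact h1
        · exact absurd (((h1.mono hD).symm.trans hadjD.reachable).trans (h2.mono hD).symm) hbr
        · exact absurd (((h2.mono hD).trans hadjD.reachable.symm).trans (h1.mono hD)) hbr
      apply hmin (B', u)
      · refine ⟨g1, gE.trans hE, ?_, z0, ?_, ?_⟩
        · show cc (red G B') ≤ _
          omega
        · show (red G B').Adj u z0
          rw [g2]; exact le_lk _ _ _ hadjD
        · show (ct (red G B') u z0).Reachable u z0
          rw [g2]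
          exact hnbD.mono (ct_mono (le_lk _ _ _) _ _)
      · show nn (red G B') u < nn (red G B) u
        have n1 := nn_lk hbr
        rw [lk_ct hz] at n1
        have n2 : nn (red G B') u = nn (ct (red G B) w z) u := by
          rw [g2, nn, nn, comp_lk_other hwy' (fun e => hbr (e.trans hzu.symm))
            (fun e => huy (e.mono (ct_le _ _ _)).symm)]
        have n3 := nn_eq hzu
        have n4 := nn_eq hw
        have n5 := nn_pos (ct (red G B) w z) w
        omega
  -- counting
  have hne : (comp (red G B) u).Nonempty := ⟨u, mem_comp.2 (SimpleGraph.Reachable.refl _)⟩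
  have h1 := hm _ hne
  have h2 := count_blue (U := comp (red G B) u) (k := k) hV.toPre
    (fun w hw => hdeg w (mem_comp.1 hw))
    (fun w hw y hy => mem_comp.2 (hclosed w (mem_comp.1 hw) y hy))
  have h3 := count_red (F := ct (red G B) u z0) (t := 1) (v := fun _ => u) (U := comp (red G B) u)
    (by intro i j hi hj _; omega) (by
      intro w
      rw [mem_comp, reach_nonbridge hz0 hnb]
      simp)
  have h4 : (iE (ct (red G B) u z0) (comp (red G B) u)).ncard < (iE (red G B) (comp (red G B) u)).ncard := by
    apply Set.ncard_lt_ncard _ (Set.toFinite _)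
    constructor
    · rintro e ⟨e1, e2⟩
      exact ⟨SimpleGraph.edgeSet_mono (ct_le _ _ _) e1, e2⟩
    · intro hsub
      have : s(u, z0) ∈ iE (ct (red G B) u z0) (comp (red G B) u) := by
        apply hsub
        refine ⟨hz0, ?_⟩
        intro w hw
        rw [Sym2.mem_iff] at hw
        rw [mem_comp]
        rcases hw with rfl | rfl
        · exact SimpleGraph.Reachable.refl _
        · exact hz0.reachable
      have h5 := this.1
      rw [SimpleGraph.mem_edgeSet, ct_adj] at h5
      tauto
  nlinarith


lemma supp_card (F : SimpleGraph V) (w : V) : (F.connectedComponentMk w).supp.ncard = nn F w := by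
  rw [nn, ← Set.ncard_coe_finset]
  congr 1
  ext u
  rw [SimpleGraph.ConnectedComponent.mem_supp_iff, SimpleGraph.ConnectedComponent.eq, Finset.mem_coe,
    mem_comp]
  exact ⟨fun h => h.symm, fun h => h.symm⟩

lemma forest_edges {F : SimpleGraph V} (hF : F.IsAcyclic) (c : F.ConnectedComponent) :
    (compEdges F c).ncard + 1 ≤ c.supp.ncard := by
  have hT := hF.isTree_connectedComponent c
  have h1 := hT.card_edgeFinset
  have h2 : compEdges F c ⊆ (Sym2.map Subtype.val) '' c.toSimpleGraph.edgeSet := by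
    rintro e ⟨h3, h4⟩
    induction e with
    | h a b =>
      refine ⟨s(⟨a, h4 a (by simp)⟩, ⟨b, h4 b (by simp)⟩), ?_, ?_⟩
      · exact h3
      · rfl
  have h3 := Set.ncard_le_ncard h2 (Set.toFinite _)
  have h4 := Set.ncard_image_le (f := Sym2.map Subtype.val) (Set.toFinite c.toSimpleGraph.edgeSet)
  have h5 : c.toSimpleGraph.edgeSet.ncard = c.toSimpleGraph.edgeFinset.card := by
    rw [← SimpleGraph.coe_edgeFinset, Set.ncard_coe_finset]
  have h6 : Fintype.card c = c.supp.ncard := by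
    rw [← Nat.card_eq_fintype_card]; rfl
  omega

lemma forest_props {κ d : ℕ} (hd : 0 < d) {F : SimpleGraph V} (hF : F.IsAcyclic)
    (hb : ∀ w, ¬ Bad κ d F w) (K : F.ConnectedComponent) :
    (compEdges F K).ncard ≤ d ∧ compDiamLE F K (2 * ((d - 1) / (κ + 1 + 1)) + 2) ∧
      (d ≡ 1 [MOD κ + 1 + 1] → compDiamLE F K (2 * ((d - 1) / (κ + 1 + 1)) + 1)) ∧
      ∀ z : ℕ, (d : ℤ) - z * (((κ + 1 : ℕ) : ℤ) - 1) + 1 ≤ ((compEdges F K).ncard : ℤ) →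
        compDiamLE F K (2 * z) := by
  have hE := forest_edges hF K
  induction K using SimpleGraph.ConnectedComponent.ind with
  | _ w =>
  rw [supp_card] at hE
  have hmem : ∀ u, u ∈ (F.connectedComponentMk w).supp → F.Reachable w u := by
    intro u hu
    rw [SimpleGraph.ConnectedComponent.mem_supp_iff, SimpleGraph.ConnectedComponent.eq] at hu
    exact hu.symm
  have key : ∀ z a b, a ∈ (F.connectedComponentMk w).supp → b ∈ (F.connectedComponentMk w).supp →
      2 * z + 1 ≤ F.dist a b → nn F w + z * κ ≤ d + 1 := by
    intro z a b ha hb' h1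
    by_contra h2
    exact hb w ⟨z, a, b, hmem a ha, hmem b hb', h1, by omega⟩
  have hL := Nat.lt_mul_div_succ (d - 1) (show 0 < κ + 1 + 1 by omega)
  refine ⟨?_, ?_, ?_, ?_⟩
  · by_contra hcon
    have : (compEdges F (F.connectedComponentMk w)).Nonempty := by
      apply Set.nonempty_of_ncard_ne_zero; omega
    obtain ⟨e, h1, h2⟩ := this
    induction e with
    | h a b =>
      have h3 := key 0 a b (h2 a (by simp)) (h2 b (by simp)) (by
        have : F.Adj a b := h1
        have := this.reachable.pos_dist_of_ne this.ne
        omega)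
      omega
  · intro a ha b hb'
    by_contra hcon
    have h1 := dist_lt_nn (hmem a ha) (hmem b hb')
    have h2 := key ((d - 1) / (κ + 1 + 1) + 1) a b ha hb' (by omega)
    generalize (d - 1) / (κ + 1 + 1) = ℓ at *
    have h3 : d ≤ (κ + 1 + 1) * (ℓ + 1) := by omega
    nlinarith
  · intro hmod a ha b hb'
    by_contra hcon
    have h1 := dist_lt_nn (hmem a ha) (hmem b hb')
    have h2 := key ((d - 1) / (κ + 1 + 1)) a b ha hb' (by omega)
    have h3 : (κ + 1 + 1) * ((d - 1) / (κ + 1 + 1)) = d - 1 :=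
      Nat.mul_div_cancel' ((Nat.modEq_iff_dvd' hd).1 hmod.symm)
    generalize (d - 1) / (κ + 1 + 1) = ℓ at *
    have h4 : d = (κ + 1 + 1) * ℓ + 1 := by omega
    nlinarith
  · intro z hz a ha b hb'
    by_contra hcon
    have h2 := key z a b ha hb' (by omega)
    have h3 : (nn F w : ℤ) + z * κ ≤ d + 1 := by exact_mod_cast h2
    have h4 : ((compEdges F (F.connectedComponentMk w)).ncard : ℤ) + 1 ≤ nn F w := by exact_mod_cast hE
    push_cast at hz
    nlinarith

lemma forest_pseudo {F : SimpleGraph V} (hF : F.IsAcyclic) : IsPseudoforest F := by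
  intro c
  have := forest_edges hF c
  omega

lemma exists_decomp {k : ℕ} (hk : 0 < k) {G : SimpleGraph V} {B : V → Finset V} (hV : Valid G k B)
    (hA : (red G B).IsAcyclic) :
    ∃ P : Fin (k + 1) → Set (Sym2 V), IsPseudoforestDecomp G (k + 1) P ∧
      SimpleGraph.fromEdgeSet (P (Fin.last k)) = red G B := by
  have hlab : ∀ u, ∃ f : V → Fin k, Set.InjOn f (B u : Set V) := by
    intro u
    obtain ⟨e⟩ : Nonempty ({w // w ∈ B u} ↪ Fin k) := by
      apply Function.Embedding.nonempty_of_card_le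
      simpa using hV.deg u
    refine ⟨fun w => if h : w ∈ B u then e ⟨w, h⟩ else ⟨0, hk⟩, ?_⟩
    intro a ha b hb hab
    have ha' : a ∈ B u := ha
    have hb' : b ∈ B u := hb
    simp only [ha', hb', dif_pos] at hab
    have := e.injective hab
    simpa using this
  choose lab hlab using hlab
  let Pb : Fin k → Set (Sym2 V) := fun c => {e | ∃ u w, w ∈ B u ∧ lab u w = c ∧ e = s(u, w)}
  let P : Fin (k + 1) → Set (Sym2 V) := Fin.snoc (α := fun _ => Set (Sym2 V)) Pb (red G B).edgeSet
  have hPl : P (Fin.last k) = (red G B).edgeSet := Fin.snoc_last (α := fun _ => Set (Sym2 V)) _ _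
  have hPc : ∀ c, P (Fin.castSucc c) = Pb c := fun c => Fin.snoc_castSucc (α := fun _ => Set (Sym2 V)) _ _ _
  have hred : ∀ c, Disjoint (Pb c) (red G B).edgeSet := by
    intro c
    rw [Set.disjoint_left]
    rintro _ ⟨u, w, h1, h2, rfl⟩ h3
    exact h3.2.1 h1
  refine ⟨P, ⟨?_, ?_, ?_, ?_⟩, ?_⟩
  · intro i
    refine Fin.lastCases ?_ (fun c => ?_) i
    · rw [hPl]
      apply SimpleGraph.edgeSet_mono
      intro a b h
      exact h.1
    · rw [hPc]
      rintro _ ⟨u, w, h1, h2, rfl⟩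
      exact hV.adj _ _ h1
  · intro i j
    refine Fin.lastCases ?_ (fun c => ?_) i <;> refine Fin.lastCases ?_ (fun c' => ?_) j
    · intro h; exact absurd rfl h
    · intro _; rw [hPl, hPc]; exact (hred c').symm
    · intro _; rw [hPl, hPc]; exact hred c
    · intro hne
      rw [hPc, hPc, Set.disjoint_left]
      rintro _ ⟨u, w, h1, h2, rfl⟩ ⟨u', w', h1', h2', h3⟩
      rw [Sym2.eq_iff] at h3
      rcases h3 with ⟨rfl, rfl⟩ | ⟨rfl, rfl⟩
      · apply hne; rw [← h2, ← h2']
      · exact hV.asym _ _ h1 h1'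
  · apply Set.Subset.antisymm
    · apply Set.iUnion_subset
      intro i
      refine Fin.lastCases ?_ (fun c => ?_) i
      · rw [hPl]
        apply SimpleGraph.edgeSet_mono
        intro a b h
        exact h.1
      · rw [hPc]
        rintro _ ⟨u, w, h1, h2, rfl⟩
        exact hV.adj _ _ h1
    · intro e he
      rw [Set.mem_iUnion]
      induction e with
      | h a b =>
        by_cases h1 : b ∈ B a
        · refine ⟨Fin.castSucc (lab a b), ?_⟩
          rw [hPc]; exact ⟨a, b, h1, rfl, rfl⟩
        · by_cases h2 : a ∈ B b
          · refine ⟨Fin.castSucc (lab b a), ?_⟩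
            rw [hPc]; exact ⟨b, a, h2, rfl, Sym2.eq_swap⟩
          · refine ⟨Fin.last k, ?_⟩
            rw [hPl]; exact ⟨he, h1, h2⟩
  · intro i
    refine Fin.lastCases ?_ (fun c => ?_) i
    · rw [hPl, SimpleGraph.fromEdgeSet_edgeSet]
      exact forest_pseudo hA
    · rw [hPc]
      intro K
      have hch : ∀ e : Sym2 V, ∃ u, e ∈ Pb c → ∃ w, w ∈ B u ∧ lab u w = c ∧ e = s(u, w) := by
        intro e
        by_cases he : e ∈ Pb c
        · obtain ⟨u, w, h⟩ := he
          exact ⟨u, fun _ => ⟨w, h⟩⟩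
        · exact ⟨e.out.1, fun h => absurd h he⟩
      choose T hT using hch
      have hin : ∀ e ∈ compEdges (SimpleGraph.fromEdgeSet (Pb c)) K, e ∈ Pb c := by
        rintro e ⟨h1, _⟩
        rw [SimpleGraph.edgeSet_fromEdgeSet] at h1
        exact h1.1
      apply Set.ncard_le_ncard_of_injOn T _ _ (Set.toFinite _)
      · intro e he
        obtain ⟨w, h1, h2, h3⟩ := hT e (hin e he)
        apply he.2
        clear h1 h2
        generalize T e = u at h3 ⊢
        rw [h3]
        exact Sym2.mem_mk_left _ _
      · intro e he e' he' hee
        obtain ⟨w, h1, h2, h3⟩ := hT e (hin e he)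
        obtain ⟨w', h1', h2', h3'⟩ := hT e' (hin e' he')
        rw [← hee] at h1' h2' h3'
        have : w = w' := hlab _ h1 h1' (h2.trans h2'.symm)
        rw [h3, h3', this]
  · rw [hPl, SimpleGraph.fromEdgeSet_edgeSet]

lemma mad_count {k d : ℕ} {G : SimpleGraph V}
    (hmad : ∀ H : G.Subgraph, H.verts.Nonempty →
      (2 * H.edgeSet.ncard : ℝ) / H.verts.ncard ≤ 2 * ((k : ℝ) + d / (d + k + 1)))
    (U : Finset V) (hU : U.Nonempty) :
    (d + k + 1) * (iE G U).ncard ≤ (k + 1) * (d + k) * U.card := by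
  have h1 := hmad ((⊤ : G.Subgraph).induce (U : Set V)) (by simpa using hU)
  have h2 : (iE G U).ncard ≤ ((⊤ : G.Subgraph).induce (U : Set V)).edgeSet.ncard := by
    apply Set.ncard_le_ncard _ (Set.toFinite _)
    rintro e ⟨h3, h4⟩
    induction e with
    | h a b =>
      rw [SimpleGraph.Subgraph.mem_edgeSet, SimpleGraph.Subgraph.induce_adj]
      exact ⟨h4 a (by simp), h4 b (by simp), h3⟩
  have h3 : ((⊤ : G.Subgraph).induce (U : Set V)).verts.ncard = U.card := by
    rw [SimpleGraph.Subgraph.induce_verts, Set.ncard_coe_finset]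
  rw [h3] at h1
  have h4 : (0 : ℝ) < U.card := by exact_mod_cast hU.card_pos
  rw [div_le_iff₀ h4] at h1
  have h5 : (0 : ℝ) < d + k + 1 := by positivity
  have h6 : ((iE G U).ncard : ℝ) ≤ ((⊤ : G.Subgraph).induce (U : Set V)).edgeSet.ncard := by
    exact_mod_cast h2
  have h7 : ((d : ℝ) + k + 1) * ((k : ℝ) + d / (d + k + 1)) = (k + 1) * (d + k) := by
    field_simp
    ring
  have h8 : ((iE G U).ncard : ℝ) ≤ ((k : ℝ) + d / (d + k + 1)) * U.card := by linarith
  have h9 := mul_le_mul_of_nonneg_left h8 h5.le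
  rw [← mul_assoc, h7] at h9
  exact_mod_cast h9

lemma exists_good {κ d : ℕ} {G : SimpleGraph V}
    (hm : ∀ U : Finset V, U.Nonempty →
      (d + κ + 2) * (iE G U).ncard ≤ (κ + 2) * (d + κ + 1) * U.card) :
    ∃ B, Valid G (κ + 1) B ∧ (red G B).IsAcyclic ∧ ∀ w, ¬ Bad κ d (red G B) w := by
  obtain ⟨B0, h1, h2, h3⟩ := exists_acyclic (k := κ + 1) (G := G) (by
    intro U hU
    have e1 := hm U hU
    have e2 := hU.card_pos
    by_contra hcon
    push Not at hcon
    have e3 := Nat.mul_le_mul_left (d + κ + 2) hcon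
    have e4 : 0 < (κ + 2) * U.card := by positivity
    nlinarith)
  by_contra hcon
  push Not at hcon
  obtain ⟨B, t, v, h⟩ := exists_opt (d := d) h1 h2 h3 hcon
  exact h.false hm

end NDT


theorem strong_nine_dragon_tree_pseudoforest_diameter
    (k d : ℕ) (hk : 0 < k) (hd : 0 < d)
    (V : Type) [Fintype V] (G : SimpleGraph V)
    (hmad : ∀ H : G.Subgraph, H.verts.Nonempty →
      (2 * H.edgeSet.ncard : ℝ) / H.verts.ncard ≤ 2 * ((k : ℝ) + d / (d + k + 1))) :
    ∃ P : Fin (k + 1) → Set (Sym2 V), IsPseudoforestDecomp G (k + 1) P ∧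
      ∃ i : Fin (k + 1),
        (SimpleGraph.fromEdgeSet (P i)).IsAcyclic ∧
        ∀ K : (SimpleGraph.fromEdgeSet (P i)).ConnectedComponent,
          (compEdges (SimpleGraph.fromEdgeSet (P i)) K).ncard ≤ d ∧
          compDiamLE (SimpleGraph.fromEdgeSet (P i)) K (2 * ((d - 1) / (k + 1)) + 2) ∧
          (d ≡ 1 [MOD k + 1] →
            compDiamLE (SimpleGraph.fromEdgeSet (P i)) K (2 * ((d - 1) / (k + 1)) + 1)) ∧
          ∀ z : ℕ,
            (d : ℤ) - z * ((k : ℤ) - 1) + 1 ≤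
                ((compEdges (SimpleGraph.fromEdgeSet (P i)) K).ncard : ℤ) →
              compDiamLE (SimpleGraph.fromEdgeSet (P i)) K (2 * z) := by
  obtain ⟨κ, rfl⟩ : ∃ κ, k = κ + 1 := ⟨k - 1, by omega⟩
  obtain ⟨B, h1, h2, h3⟩ := NDT.exists_good (κ := κ) (d := d) (G := G) (by
    intro U hU
    exact NDT.mad_count (k := κ + 1) hmad U hU)
  obtain ⟨P, hP, hPl⟩ := NDT.exists_decomp hk h1 h2
  refine ⟨P, hP, Fin.last _, ?_⟩
  rw [hPl]
  exact ⟨h2, fun K => NDT.forest_props hd h2 h3 K⟩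
end

section
/- Let k and d be positive integers with d ≤ k+1. Every finite simple graph G with maximum average degree mad(G) ≤ 2(k + d/(d+k+1)) admits a partition of its edge set into k+1 parts, each of which spans a pseudoforest, such that one of the parts F is acyclic, every connected component of F has at most d edges, and every connected component of F is a star. -/
open SimpleGraph

set_option linter.unusedSectionVars false
set_option linter.unusedSimpArgs false

namespace StarNDT
open Finset

variable {V : Type} [Fintype V] [DecidableEq V]

/-- blue out-neighbours -/
def Bl (D : V → Finset V) (c : V → V) (u : V) : Finset V := (D u).erase (c u)

/-- the red component of `x` -/
def comp (c : V → V) (x : V) : Finset V := univ.filter (fun u => c u = c x)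

structure Ori (G : SimpleGraph V) (D : V → Finset V) : Prop where
  adj : ∀ u v, G.Adj u v ↔ v ∈ D u ∨ u ∈ D v
  asym : ∀ u v, v ∈ D u → u ∉ D v

structure StarS (D : V → Finset V) (c : V → V) : Prop where
  idem : ∀ v, c (c v) = c v
  mem : ∀ v, c v ≠ v → c v ∈ D v

def flip (D : V → Finset V) (x y : V) : V → Finset V := fun v =>
  if v = x then (D x).erase y else if v = y then insert x (D y) else D v

def InU (c : V → V) (w : ℕ → V) (j : ℕ) (q : V) : Prop := ∃ l < j, c q = c (w l)

def Legal (D : V → Finset V) (c : V → V) (a : V) (w : ℕ → V) (t : ℕ) : Prop :=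
  w 0 = a ∧ ∀ i < t, 0 < i → ¬ InU c w i (w i) ∧ ∃ p, InU c w i p ∧ w i ∈ Bl D c p

def Deg (k : ℕ) (a : V) (D : V → Finset V) (c : V → V) : Prop :=
  ∀ u, (Bl D c u).card ≤ k + if u = a then 1 else 0

def DegF (k : ℕ) (a v : V) (D : V → Finset V) (c : V → V) : Prop :=
  ∀ u, (Bl D c u).card + (if u = v then 1 else 0) ≤ k + if u = a then 1 else 0

def Done (G : SimpleGraph V) (k d : ℕ) : Prop :=
  ∃ D c, Ori G D ∧ StarS D c ∧ (∀ x, (comp c x).card ≤ d + 1) ∧ ∀ u, (Bl D c u).card ≤ k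

def Improves (G : SimpleGraph V) (k d : ℕ) (a : V) (w : ℕ → V) (σ : ℕ → ℕ) (j : ℕ) : Prop :=
  ∃ D c, Ori G D ∧ StarS D c ∧ (∀ x, (comp c x).card ≤ d + 1) ∧ Deg k a D c ∧
    Legal D c a w (j + 1) ∧ (∀ l < j, (comp c (w l)).card = σ l) ∧ (comp c (w j)).card < σ j

lemma Ori.irrefl {G : SimpleGraph V} {D} (h : Ori G D) (v : V) : v ∉ D v :=
  fun hv => h.asym v v hv hv

lemma Ori.flip {G : SimpleGraph V} {D} (h : Ori G D) {x y : V} (hxy : y ∈ D x) :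
    Ori G (flip D x y) := by
  have hne : y ≠ x := by rintro rfl; exact h.irrefl _ hxy
  have h2 := h.asym _ _ hxy
  constructor
  · intro u v
    rw [h.adj]
    unfold StarNDT.flip
    by_cases h1 : u = x <;> by_cases h3 : u = y <;> by_cases h4 : v = x <;> by_cases h5 : v = y <;>
      grind
  · intro u v
    have := h.asym u v
    have := h.irrefl x
    unfold StarNDT.flip
    by_cases h1 : u = x <;> by_cases h3 : u = y <;> by_cases h4 : v = x <;> by_cases h5 : v = y <;>
      grind

lemma mem_comp {c : V → V} {x u : V} : u ∈ comp c x ↔ c u = c x := by simp [comp]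

lemma InU.mono {c : V → V} {w : ℕ → V} {i j : ℕ} (hij : i ≤ j) {q : V} (h : InU c w i q) :
    InU c w j q := by
  obtain ⟨l, hl, e⟩ := h; exact ⟨l, by omega, e⟩

lemma Legal.mono {D : V → Finset V} {c a} {w : ℕ → V} {s t} (h : Legal D c a w t) (hst : s ≤ t) :
    Legal D c a w s := ⟨h.1, fun i hi => h.2 i (by omega)⟩

lemma Legal.notInU {D : V → Finset V} {c a} {w : ℕ → V} {t} (h : Legal D c a w t) {i} (hi : i < t) :
    ¬ InU c w i (w i) := by
  rcases Nat.eq_zero_or_pos i with rfl | h0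
  · rintro ⟨l, hl, _⟩; omega
  · exact (h.2 i hi h0).1

/-- transfer of legality and sizes to a new state -/
lemma transfer {D D' : V → Finset V} {c c' : V → V} {a : V} {w : ℕ → V} {j : ℕ}
    (h : Legal D c a w (j + 1))
    (H1 : ∀ q, InU c w j q → c' q = c q)
    (H2 : ∀ q, ¬ InU c w j q → ∀ l < j, c' q ≠ c (w l))
    (H3 : ∀ q, InU c w j q → ∀ m ≤ j, w m ∈ Bl D c q → w m ∈ Bl D' c' q) :
    Legal D' c' a w (j + 1) ∧ ∀ l < j, comp c' (w l) = comp c (w l) := by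
  have hw : ∀ l < j, c' (w l) = c (w l) := fun l hl => H1 _ ⟨l, hl, rfl⟩
  have key : ∀ q, ∀ l < j, (c' q = c' (w l) ↔ c q = c (w l)) := by
    intro q l hl
    rw [hw l hl]
    by_cases hq : InU c w j q
    · rw [H1 q hq]
    · exact ⟨fun e => absurd e (H2 q hq l hl), fun e => absurd ⟨l, hl, e⟩ hq⟩
  have keyU : ∀ i ≤ j, ∀ q, InU c' w i q ↔ InU c w i q := by
    intro i hi q
    constructor
    · rintro ⟨l, hl, e⟩; exact ⟨l, hl, (key q l (by omega)).1 e⟩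
    · rintro ⟨l, hl, e⟩; exact ⟨l, hl, (key q l (by omega)).2 e⟩
  refine ⟨⟨h.1, fun i hi h0 => ?_⟩, fun l hl => ?_⟩
  · obtain ⟨h1, p, hp, hm⟩ := h.2 i hi h0
    refine ⟨by rwa [keyU i (by omega)], p, (keyU i (by omega) p).2 hp, ?_⟩
    exact H3 p (hp.mono (by omega)) i (by omega) hm
  · ext q; rw [mem_comp, mem_comp, key q l hl]

/-- deleting the red edge between a center `v` and the entry leaf `w j` -/
lemma delete_center {G : SimpleGraph V} {k d : ℕ} {a v : V} {D c} {w : ℕ → V} {j : ℕ}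
    (hO : Ori G D) (hS : StarS D c) (hsz : ∀ x, c x ≠ v → (comp c x).card ≤ d + 1)
    (hszv : (comp c v).card ≤ d + 2)
    (hD : DegF k a v D c) (hL : Legal D c a w (j + 1)) (hv : c (w j) = v) (hne : v ≠ w j)
    {σ : ℕ → ℕ} (hσ : ∀ l < j, (comp c (w l)).card = σ l) (hσj : 1 < σ j) :
    Improves G k d a w σ j := by
  have hcv : c v = v := by rw [← hv, hS.idem]
  have hm : v ∈ D (w j) := by have := hS.mem (w j) (by rw [hv]; exact hne); rwa [hv] at this
  have hN := hL.notInU (Nat.lt_succ_self j)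
  have hleaf : ∀ u, c u ≠ w j := by
    intro u hu
    have := hS.idem u
    rw [hu, hv] at this; exact hne this
  have hT := transfer (D' := flip D (w j) v) (c' := Function.update c (w j) (w j)) hL
    (by
      intro q hq
      have : q ≠ w j := by rintro rfl; exact hN hq
      simp [Function.update_of_ne this])
    (by
      intro q hq l hl
      by_cases e : q = w j
      · subst e; simp only [Function.update_self]; exact fun e => hleaf _ e.symm
      · rw [Function.update_of_ne e]; exact fun e' => hq ⟨l, hl, e'⟩)
    (by
      intro q hq m hm' hmq
      have e1 : q ≠ w j := by rintro rfl; exact hN hq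
      have e2 : q ≠ v := by
        rintro rfl; obtain ⟨l, hl, e⟩ := hq; exact hN ⟨l, hl, by rw [← e, hv, hcv]⟩
      simpa [Bl, flip, Function.update_of_ne e1, e1, e2] using hmq)
  have hcj : comp (Function.update c (w j) (w j)) (w j) = {w j} := by
    ext u
    simp only [mem_comp, Function.update_self, mem_singleton]
    by_cases e : u = w j
    · simp [e]
    · simp [Function.update_of_ne e, e, hleaf]
  refine ⟨_, _, hO.flip hm, ⟨?_, ?_⟩, ?_, ?_, hT.1, ?_, ?_⟩
  · intro u
    by_cases e : u = w j
    · simp [e]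
    · rw [Function.update_of_ne e, Function.update_of_ne (hleaf u), hS.idem]
  · intro u hu
    by_cases e : u = w j
    · simp [e] at hu
    · rw [Function.update_of_ne e] at hu ⊢
      have := hS.mem u hu
      simp only [flip, if_neg e]
      split_ifs with h
      · subst h; exact mem_insert_of_mem this
      · exact this
  · intro x
    by_cases e : x = w j
    · rw [e, hcj]; simp
    · by_cases e2 : c x = v
      · have : comp (Function.update c (w j) (w j)) x ⊆ (comp c v).erase (w j) := by
          intro u
          rw [mem_comp, Function.update_of_ne e, mem_erase, mem_comp, hcv]
          by_cases e3 : u = w j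
          · subst e3; simp [e2, hne.symm]
          · simp [Function.update_of_ne e3, e3, e2]
        have h1 := card_le_card this
        rw [card_erase_of_mem (by rw [mem_comp, hv, hcv])] at h1
        omega
      · refine le_trans (card_le_card ?_) (hsz x e2)
        intro u
        rw [mem_comp, mem_comp, Function.update_of_ne e]
        by_cases e3 : u = w j
        · subst e3; simp only [Function.update_self]; exact fun e => absurd e.symm (hleaf _)
        · rw [Function.update_of_ne e3]; exact id
  · intro u
    have hDu := hD u
    by_cases e : u = w j
    · subst e
      simp only [Bl, flip, if_true, Function.update_self] at hDu ⊢
      rw [hv] at hDu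
      rw [erase_eq_of_notMem (a := w j)]
      · omega
      · intro h; exact hO.irrefl _ (mem_of_mem_erase h)
    · by_cases e2 : u = v
      · subst e2
        simp only [Bl, flip, if_true, Function.update_of_ne e, hcv, if_neg e] at hDu ⊢
        refine le_trans (card_le_card (erase_subset _ _)) ?_
        refine le_trans (card_insert_le _ _) ?_
        rwa [erase_eq_of_notMem (hO.irrefl _)] at hDu
      · simp only [Bl, flip, Function.update_of_ne e, if_neg e, if_neg e2] at hDu ⊢
        omega
  · intro l hl; rw [hT.2 l hl, hσ l hl]
  · rw [hcj]; simpa using hσj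

/-- deleting a red edge at the freed vertex `v`. -/
lemma delete {G : SimpleGraph V} {k d : ℕ} {a v : V} {D c} {w : ℕ → V} {j : ℕ}
    (hO : Ori G D) (hS : StarS D c) (hsz : ∀ x, (comp c x).card ≤ d + 1)
    (hD : DegF k a v D c) (hL : Legal D c a w (j + 1)) (hv : c v = c (w j)) (hne : v ≠ w j)
    {σ : ℕ → ℕ} (hσ : ∀ l ≤ j, (comp c (w l)).card = σ l) :
    Improves G k d a w σ j := by
  have hσj : 1 < σ j := by
    rw [← hσ j le_rfl, one_lt_card]
    exact ⟨v, by rw [mem_comp, hv], w j, by rw [mem_comp], hne⟩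
  by_cases hcv : c v = v
  · exact delete_center hO hS (fun x _ => hsz x) (by have := hsz v; omega) hD hL
      (by rw [← hv, hcv]) hne (fun l hl => hσ l hl.le) hσj
  have hN := hL.notInU (Nat.lt_succ_self j)
  have hNv : ¬ InU c w j v := by
    rintro ⟨l, hl, e⟩; exact hN ⟨l, hl, by rw [← e, hv]⟩
  have hleaf : ∀ u, c u ≠ v := by
    intro u hu
    have := hS.idem u
    rw [hu] at this; exact hcv this
  have hT := transfer (D' := D) (c' := Function.update c v v) hL
    (by
      intro q hq
      have : q ≠ v := by rintro rfl; exact hNv hq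
      simp [Function.update_of_ne this])
    (by
      intro q hq l hl
      by_cases e : q = v
      · subst e; simp only [Function.update_self]; exact fun e => hleaf _ e.symm
      · rw [Function.update_of_ne e]; exact fun e' => hq ⟨l, hl, e'⟩)
    (by
      intro q hq m hm' hmq
      have e1 : q ≠ v := by rintro rfl; exact hNv hq
      simpa [Bl, Function.update_of_ne e1] using hmq)
  have hsub : ∀ x, x ≠ v → comp (Function.update c v v) x ⊆ (comp c x).erase v := by
    intro x e u
    rw [mem_comp, mem_erase, mem_comp, Function.update_of_ne e]
    by_cases e3 : u = v
    · subst e3; simp only [Function.update_self]; exact fun e => absurd e.symm (hleaf _)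
    · rw [Function.update_of_ne e3]; exact fun h => ⟨e3, h⟩
  refine ⟨_, _, hO, ⟨?_, ?_⟩, ?_, ?_, hT.1, ?_, ?_⟩
  · intro u
    by_cases e : u = v
    · simp [e]
    · rw [Function.update_of_ne e, Function.update_of_ne (hleaf u), hS.idem]
  · intro u hu
    by_cases e : u = v
    · simp [e] at hu
    · rw [Function.update_of_ne e] at hu ⊢
      exact hS.mem u hu
  · intro x
    by_cases e : x = v
    · have : comp (Function.update c v v) x = {v} := by
        ext u
        rw [mem_comp, e, Function.update_self, mem_singleton]
        by_cases e3 : u = v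
        · simp [e3]
        · simp [Function.update_of_ne e3, e3, hleaf]
      rw [this]; simp
    · exact le_trans (card_le_card ((hsub x e).trans (erase_subset _ _))) (hsz x)
  · intro u
    have hDu := hD u
    by_cases e : u = v
    · subst e
      simp only [Bl, Function.update_self, if_true] at hDu ⊢
      rw [card_erase_of_mem (hS.mem _ hcv)] at hDu
      have := card_le_card (erase_subset u (D u))
      omega
    · simp only [Bl, Function.update_of_ne e, if_neg e] at hDu ⊢
      omega
  · intro l hl; rw [hT.2 l hl, hσ l hl.le]
  · rw [← hσ j le_rfl]
    refine lt_of_le_of_lt (card_le_card (hsub _ hne.symm)) ?_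
    exact card_lt_card (erase_ssubset (by rw [mem_comp, hv]))

lemma free_entry {G : SimpleGraph V} {k d : ℕ} {a : V} {w : ℕ → V} (i : ℕ) : ∀ {D c},
    Ori G D → StarS D c → (∀ x, (comp c x).card ≤ d + 1) →
    DegF k a (w i) D c → Legal D c a w (i + 1) → ∀ {σ : ℕ → ℕ},
    (∀ l < i, (comp c (w l)).card = σ l) → Done G k d ∨ ∃ j < i, Improves G k d a w σ j := by
  induction i using Nat.strong_induction_on with
  | _ i ih =>
  intro D c hO hS hsz hD hL σ hσ
  rcases Nat.eq_zero_or_pos i with rfl | h0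
  · left
    refine ⟨D, c, hO, hS, hsz, fun u => ?_⟩
    have := hD u
    rw [hL.1] at this
    omega
  obtain ⟨hN, p, hp, hm⟩ := hL.2 i (by omega) h0
  have hpw : p ≠ w i := by rintro rfl; exact hN hp
  obtain ⟨l, hl, hpl⟩ := hp
  have hmD : w i ∈ D p := mem_of_mem_erase hm
  have hcp : c p ≠ w i := (ne_of_mem_erase hm).symm
  have hS' : StarS (flip D p (w i)) c := by
    refine ⟨hS.idem, fun u hu => ?_⟩
    have := hS.mem u hu
    simp only [flip]
    split_ifs with h1 h2
    · subst h1; exact mem_erase.2 ⟨hcp, this⟩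
    · subst h2; exact mem_insert_of_mem this
    · exact this
  have hD' : DegF k a p (flip D p (w i)) c := by
    intro u
    have hDu := hD u
    by_cases e : u = p
    · subst e
      simp only [Bl, flip, if_true, if_neg hpw] at hDu ⊢
      rw [erase_right_comm]
      rw [card_erase_of_mem (show w i ∈ (D u).erase (c u) from hm)]
      have : 0 < (Bl D c u).card := card_pos.2 ⟨_, hm⟩
      simp only [Bl] at this
      omega
    · by_cases e2 : u = w i
      · subst e2
        simp only [Bl, flip, if_true, if_neg e] at hDu ⊢
        have := card_le_card (show (insert p (D (w i))).erase (c (w i)) ⊆ insert p ((D (w i)).erase (c (w i))) by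
          intro z; simp only [mem_erase, mem_insert]; tauto)
        have := card_insert_le p ((D (w i)).erase (c (w i)))
        omega
      · simp only [Bl, flip, if_neg e, if_neg e2] at hDu ⊢
        omega
  have hL' : Legal (flip D p (w i)) c a w (l + 1) := by
    refine ⟨hL.1, fun m hm h0m => ?_⟩
    obtain ⟨h1, q, hq, hmq⟩ := hL.2 m (by omega) h0m
    refine ⟨h1, q, hq, ?_⟩
    have hwm : w m ≠ w i := by
      intro e; exact hN ⟨m, by omega, by rw [e]⟩
    simp only [Bl, flip, mem_erase] at hmq ⊢
    refine ⟨hmq.1, ?_⟩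
    split_ifs with h1 h2
    · subst h1; exact mem_erase.2 ⟨hwm, hmq.2⟩
    · subst h2; exact mem_insert_of_mem hmq.2
    · exact hmq.2
  by_cases hpe : p = w l
  · subst hpe
    rcases ih l hl (hO.flip hmD) hS' hsz hD' hL' (σ := σ) (fun m hm => hσ m (by omega)) with h | ⟨j, hj, h⟩
    · exact Or.inl h
    · exact Or.inr ⟨j, by omega, h⟩
  · exact Or.inr ⟨l, hl, delete (hO.flip hmD) hS' hsz hD' hL' hpl hpe (fun m hm => hσ m (by omega))⟩

lemma merge {G : SimpleGraph V} {k : ℕ} {a p y : V} {D c} {w : ℕ → V} {j : ℕ}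
    (hO : Ori G D) (hS : StarS D c) (hD : Deg k a D c) (hL : Legal D c a w (j + 1))
    (hcp : c p = p) (hpj : c p = c (w j)) (hy : y ∈ Bl D c p) (hyi : ∀ u, c u = c y → u = y)
    (hyU : ¬ InU c w (j + 1) y) :
    Ori G (flip D p y) ∧ StarS (flip D p y) (Function.update c y p) ∧
    DegF k a p (flip D p y) (Function.update c y p) ∧
    Legal (flip D p y) (Function.update c y p) a w (j + 1) ∧
    (∀ l < j, comp (Function.update c y p) (w l) = comp c (w l)) ∧
    (comp (Function.update c y p) p) = insert y (comp c p) ∧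
    (∀ x, Function.update c y p x ≠ p → comp (Function.update c y p) x ⊆ comp c x) := by
  have hyD : y ∈ D p := mem_of_mem_erase hy
  have hcy : c y = y := hyi _ (hS.idem y)
  have hpy : p ≠ y := by rintro rfl; exact hO.irrefl _ hyD
  have hN := hL.notInU (Nat.lt_succ_self j)
  have hNp : ¬ InU c w j p := by
    rintro ⟨l, hl, e⟩; exact hN ⟨l, hl, by rw [← e, hpj]⟩
  have hNy : ¬ InU c w j y := fun h => hyU (h.mono (by omega))
  have hcu : ∀ u, u ≠ y → c u ≠ y := fun u hu e => hu (hyi u (by rw [e, hcy]))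
  have hT := transfer (D' := flip D p y) (c' := Function.update c y p) hL
    (by
      intro q hq
      have : q ≠ y := by rintro rfl; exact hNy hq
      simp [Function.update_of_ne this])
    (by
      intro q hq l hl
      by_cases e : q = y
      · subst e; simp only [Function.update_self]
        intro e; exact hNp ⟨l, hl, by rw [hcp, e]⟩
      · rw [Function.update_of_ne e]; exact fun e' => hq ⟨l, hl, e'⟩)
    (by
      intro q hq m hm' hmq
      have e1 : q ≠ p := by rintro rfl; exact hNp hq
      have e2 : q ≠ y := by rintro rfl; exact hNy hq
      simpa [Bl, flip, Function.update_of_ne e2, e1, e2] using hmq)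
  refine ⟨hO.flip hyD, ⟨?_, ?_⟩, ?_, hT.1, hT.2, ?_, ?_⟩
  · intro u
    by_cases e : u = y
    · simp [e, Function.update_of_ne hpy, hcp]
    · rw [Function.update_of_ne e, Function.update_of_ne (hcu u e), hS.idem]
  · intro u hu
    by_cases e : u = y
    · subst e; simp [flip, hpy.symm]
    · rw [Function.update_of_ne e] at hu ⊢
      have := hS.mem u hu
      simp only [flip, if_neg e]
      split_ifs with h
      · subst h; exact absurd hcp hu
      · exact this
  · intro u
    have hDu := hD u
    by_cases e : u = p
    · subst e
      simp only [Bl, flip, if_true, Function.update_of_ne hpy] at hDu ⊢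
      rw [erase_right_comm, card_erase_of_mem (show y ∈ (D u).erase (c u) from hy)]
      have : 0 < (Bl D c u).card := card_pos.2 ⟨_, hy⟩
      simp only [Bl] at this
      omega
    · by_cases e2 : u = y
      · subst e2
        simp only [Bl, flip, if_true, if_neg e, Function.update_self] at hDu ⊢
        rw [hcy, erase_eq_of_notMem (hO.irrefl _)] at hDu
        rw [erase_insert (hO.asym _ _ hyD)]
        omega
      · simp only [Bl, flip, if_neg e, if_neg e2, Function.update_of_ne e2] at hDu ⊢
        omega
  · ext u
    rw [mem_comp, mem_insert, mem_comp, Function.update_of_ne hpy, hcp]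
    by_cases e : u = y
    · simp [e]
    · simp [e]
  · intro x hx u
    rw [mem_comp, mem_comp]
    by_cases e : x = y
    · simp [e] at hx
    · rw [Function.update_of_ne e] at hx ⊢
      by_cases e2 : u = y
      · subst e2; rw [Function.update_self]; exact fun h => absurd h.symm hx
      · rw [Function.update_of_ne e2]; exact id

/-- rematch the leaf `p` to the isolated vertex `y` -/
lemma swap_leaf {G : SimpleGraph V} {k d : ℕ} {a p y : V} {D c} {w : ℕ → V} {j : ℕ} (hd : 0 < d)
    (hO : Ori G D) (hS : StarS D c) (hsz : ∀ x, (comp c x).card ≤ d + 1)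
    (hD : Deg k a D c) (hL : Legal D c a w (j + 1))
    (hcp : c p ≠ p) (hpj : c p = c (w j)) (hy : y ∈ Bl D c p) (hyi : ∀ u, c u = c y → u = y)
    (hyU : ¬ InU c w (j + 1) y) (h : p ≠ w j ∨ 2 < (comp c (w j)).card)
    {σ : ℕ → ℕ} (hσ : ∀ l ≤ j, (comp c (w l)).card = σ l) :
    Improves G k d a w σ j := by
  have hyD : y ∈ D p := mem_of_mem_erase hy
  have hcy : c y = y := hyi _ (hS.idem y)
  have hpy : p ≠ y := by rintro rfl; exact hO.irrefl _ hyD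
  have hN := hL.notInU (Nat.lt_succ_self j)
  have hNp : ¬ InU c w j p := by
    rintro ⟨l, hl, e⟩; exact hN ⟨l, hl, by rw [← e, hpj]⟩
  have hleaf : ∀ u, c u ≠ p := by
    intro u hu
    have := hS.idem u
    rw [hu] at this; exact hcp this
  have hT := transfer (D' := D) (c' := Function.update c p y) hL
    (by
      intro q hq
      have : q ≠ p := by rintro rfl; exact hNp hq
      simp [Function.update_of_ne this])
    (by
      intro q hq l hl
      by_cases e : q = p
      · subst e; simp only [Function.update_self]
        intro e; exact hyU ⟨l, by omega, by rw [hcy, e]⟩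
      · rw [Function.update_of_ne e]; exact fun e' => hq ⟨l, hl, e'⟩)
    (by
      intro q hq m hm' hmq
      have e1 : q ≠ p := by rintro rfl; exact hNp hq
      simpa [Bl, Function.update_of_ne e1] using hmq)
  have hnew : ∀ x, Function.update c p y x = y → (comp (Function.update c p y) x).card ≤ 2 := by
    intro x hx
    refine le_trans (card_le_card (t := {p, y}) ?_) card_le_two
    intro u
    rw [mem_comp, hx, mem_insert, mem_singleton]
    by_cases e : u = p
    · simp [e]
    · rw [Function.update_of_ne e]; exact fun h => Or.inr (hyi u (by rw [h, hcy]))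
  have hsub : ∀ x, Function.update c p y x ≠ y → x ≠ p ∧ comp (Function.update c p y) x ⊆ (comp c x).erase p := by
    intro x hx
    have e : x ≠ p := by rintro rfl; simp at hx
    refine ⟨e, ?_⟩
    intro u
    rw [mem_comp, mem_erase, mem_comp]
    rw [Function.update_of_ne e] at hx ⊢
    by_cases e3 : u = p
    · subst e3; simp only [Function.update_self]; exact fun e => absurd e.symm hx
    · rw [Function.update_of_ne e3]; exact fun h => ⟨e3, h⟩
  refine ⟨_, _, hO, ⟨?_, ?_⟩, ?_, ?_, hT.1, ?_, ?_⟩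
  · intro u
    by_cases e : u = p
    · simp [e, Function.update_of_ne hpy.symm, hcy]
    · rw [Function.update_of_ne e, Function.update_of_ne (hleaf u), hS.idem]
  · intro u hu
    by_cases e : u = p
    · subst e; simpa using hyD
    · rw [Function.update_of_ne e] at hu ⊢
      exact hS.mem u hu
  · intro x
    by_cases e : Function.update c p y x = y
    · have := hnew x e; omega
    · exact le_trans (card_le_card ((hsub x e).2.trans (erase_subset _ _))) (hsz x)
  · intro u
    have hDu := hD u
    by_cases e : u = p
    · subst e
      simp only [Bl, Function.update_self] at hDu ⊢
      rw [card_erase_of_mem (hS.mem _ hcp)] at hDu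
      rwa [card_erase_of_mem hyD]
    · simpa only [Bl, Function.update_of_ne e] using hDu
  · intro l hl; rw [hT.2 l hl, hσ l hl.le]
  · rw [← hσ j le_rfl]
    by_cases e : Function.update c p y (w j) = y
    · have h1 := hnew _ e
      rcases h with h | h
      · rw [Function.update_of_ne h.symm] at e
        exact absurd ⟨j, by omega, by rw [hcy, e]⟩ hyU
      · omega
    · refine lt_of_le_of_lt (card_le_card (hsub _ e).2) ?_
      exact card_lt_card (erase_ssubset (by rw [mem_comp, hpj]))

/-- isolated child of a non-full component, whose entry vertex is the center -/
lemma merge_entry {G : SimpleGraph V} {k d : ℕ} {a y : V} {D c} {w : ℕ → V} {j : ℕ}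
    (hO : Ori G D) (hS : StarS D c) (hsz : ∀ x, (comp c x).card ≤ d + 1)
    (hD : Deg k a D c) (hL : Legal D c a w (j + 1))
    (hcp : c (w j) = w j) (hy : y ∈ Bl D c (w j)) (hyi : ∀ u, c u = c y → u = y)
    (hyU : ¬ InU c w (j + 1) y) (hd : (comp c (w j)).card ≤ d)
    {σ : ℕ → ℕ} (hσ : ∀ l < j, (comp c (w l)).card = σ l) :
    Done G k d ∨ ∃ i < j, Improves G k d a w σ i := by
  obtain ⟨h1, h2, h3, h4, h5, h6, h7⟩ := merge hO hS hD hL hcp rfl hy hyi hyU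
  refine free_entry j h1 h2 ?_ h3 h4 (fun l hl => by rw [h5 l hl, hσ l hl])
  intro x
  by_cases e : Function.update c y (w j) x = w j
  · have : comp (Function.update c y (w j)) x = comp (Function.update c y (w j)) (w j) := by
      ext u
      have e2 : w j ≠ y := by
        rintro e3; exact hyU ⟨j, by omega, by rw [e3]⟩
      rw [mem_comp, mem_comp, e, Function.update_of_ne e2, hcp]
    rw [this, h6]
    have := card_insert_le y (comp c (w j))
    omega
  · exact le_trans (card_le_card (h7 x e)) (hsz x)

lemma recenter {G : SimpleGraph V} {k d : ℕ} {a y p : V} {D c} {w : ℕ → V} {j : ℕ}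
    (hO : Ori G D) (hS : StarS D c) (hsz : ∀ x, (comp c x).card ≤ d + 1)
    (hD : Deg k a D c) (hL : Legal D c a w (j + 1)) (hp : p = w j)
    (hcp : c p ≠ p) (hy : y ∈ Bl D c p) (hyi : ∀ u, c u = c y → u = y)
    (hyU : ¬ InU c w (j + 1) y) (hd : (comp c p).card ≤ d) (h2 : (comp c p).card ≤ 2)
    {σ : ℕ → ℕ} (hσ : ∀ l < j, (comp c (w l)).card = σ l) :
    Done G k d ∨ ∃ i < j, Improves G k d a w σ i := by
  obtain ⟨z, hz⟩ : ∃ z, z = c p := ⟨_, rfl⟩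
  have hzp : z ≠ p := by rwa [hz]
  have hcz : c z = z := by rw [hz, hS.idem]
  have hzD : z ∈ D p := hz ▸ hS.mem p hcp
  have hcomp : comp c p = {p, z} := by
    symm
    apply eq_of_subset_of_card_le
    · intro u; rw [mem_insert, mem_singleton, mem_comp]
      rintro (rfl | rfl)
      · rfl
      · rw [hcz, hz]
    · rw [card_pair hzp.symm]; exact h2
  have hcu : ∀ u, u ≠ p → u ≠ z → c u ≠ p ∧ c u ≠ z := by
    intro u h1 h2
    constructor
    · intro e; have := hS.idem u; rw [e] at this; exact hcp this
    · intro e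
      have : u ∈ comp c p := by rw [mem_comp, e, hz]
      rw [hcomp] at this; simp [h1, h2] at this
  obtain ⟨c', hc'⟩ : ∃ c' : V → V, c' = fun u => if u = p ∨ u = z then p else c u := ⟨_, rfl⟩
  have c1 : c' p = p := by simp [hc']
  have c2 : c' z = p := by simp [hc']
  have c3 : ∀ u, u ≠ p → u ≠ z → c' u = c u := by
    intro u h1 h2; simp [hc', h1, h2]
  have hBl : ∀ u, Bl (flip D p z) c' u = Bl D c u := by
    intro u
    by_cases e : u = p
    · subst e
      simp only [Bl, flip, if_true, c1, ← hz]
      exact erase_eq_of_notMem (fun h => hO.irrefl _ (mem_of_mem_erase h))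
    · by_cases e2 : u = z
      · subst e2
        simp only [Bl, flip, if_true, if_neg e, c2, hcz]
        rw [erase_insert (hO.asym _ _ hzD), erase_eq_of_notMem (hO.irrefl _)]
      · simp only [Bl, flip, if_neg e, if_neg e2, c3 u e e2]
  have hcc : ∀ u v, c' u = c' v ↔ c u = c v := by
    intro u v
    have hp' := hz.symm
    by_cases e1 : u = p <;> by_cases e2 : u = z <;> by_cases e3 : v = p <;> by_cases e4 : v = z <;>
      have := hcu u <;> have := hcu v <;> have := c3 u <;> have := c3 v <;> grind
  have hcompc : ∀ x, comp c' x = comp c x := by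
    intro x; ext u; rw [mem_comp, mem_comp, hcc]
  have hU : ∀ i q, InU c' w i q ↔ InU c w i q := by
    intro i q; simp only [InU, hcc]
  subst hp
  refine merge_entry (D := flip D (w j) z) (c := c') (y := y) (hO.flip hzD) ⟨?_, ?_⟩ ?_ ?_ ?_ c1 ?_ ?_ ?_ ?_ ?_
  · intro u; rw [hcc, ]
    by_cases e : u = w j
    · rw [e, c1]
    · by_cases e2 : u = z
      · rw [e2, c2, hcz, ← hz]
      · rw [c3 u e e2, hS.idem]
  · intro u hu
    by_cases e : u = w j
    · rw [e] at hu; exact absurd c1 hu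
    · by_cases e2 : u = z
      · rw [e2, c2]; simp [flip, hzp]
      · rw [c3 u e e2] at hu ⊢
        simp only [flip, if_neg e, if_neg e2]; exact hS.mem u hu
  · intro x; rw [hcompc]; exact hsz x
  · intro u; rw [hBl]; exact hD u
  · refine ⟨hL.1, fun i hi h0 => ?_⟩
    simp only [hU, hBl]; exact hL.2 i hi h0
  · rw [hBl]; exact hy
  · intro u; rw [hcc]; exact hyi u
  · rwa [hU]
  · rwa [hcompc]
  · intro l hl; rw [hcompc, hσ l hl]

/-- structure of isolated children -/
lemma isolated_child {G : SimpleGraph V} {k d : ℕ} {a y p : V} {D c} {w : ℕ → V} {j : ℕ}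
    (hd : 0 < d)
    (hO : Ori G D) (hS : StarS D c) (hsz : ∀ x, (comp c x).card ≤ d + 1)
    (hD : Deg k a D c) (hL : Legal D c a w (j + 1)) (hpj : c p = c (w j))
    (hy : y ∈ Bl D c p) (hyi : ∀ u, c u = c y → u = y)
    (hyU : ¬ InU c w (j + 1) y)
    {σ : ℕ → ℕ} (hσ : ∀ l ≤ j, (comp c (w l)).card = σ l) :
    (Done G k d ∨ ∃ i ≤ j, Improves G k d a w σ i) ∨ (p = w j ∧ d + 1 ≤ σ j) := by
  by_cases hp : p = w j
  · by_cases hdj : d + 1 ≤ σ j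
    · exact Or.inr ⟨hp, hdj⟩
    left
    have hcard : (comp c (w j)).card ≤ d := by have := hσ j le_rfl; omega
    have fin : (Done G k d ∨ ∃ i < j, Improves G k d a w σ i) →
        Done G k d ∨ ∃ i ≤ j, Improves G k d a w σ i := by
      rintro (h | ⟨i, hi, h⟩)
      · exact Or.inl h
      · exact Or.inr ⟨i, hi.le, h⟩
    by_cases hcp : c p = p
    · subst hp
      exact fin (merge_entry hO hS hsz hD hL hcp hy hyi hyU hcard (fun l hl => hσ l hl.le))
    · by_cases h2 : (comp c (w j)).card ≤ 2
      · exact fin (recenter hO hS hsz hD hL hp hcp hy hyi hyU (by rwa [hp]) (by rwa [hp])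
          (fun l hl => hσ l hl.le))
      · exact Or.inr ⟨j, le_rfl, swap_leaf hd hO hS hsz hD hL hcp hpj hy hyi hyU
          (Or.inr (by omega)) hσ⟩
  · left; right
    refine ⟨j, le_rfl, ?_⟩
    by_cases hcp : c p = p
    · obtain ⟨h1, h2, h3, h4, h5, h6, h7⟩ := merge hO hS hD hL hcp hpj hy hyi hyU
      have hwy : w j ≠ y := by
        rintro e3; exact hyU ⟨j, by omega, by rw [e3]⟩
      have hpy : p ≠ y := by
        rintro rfl; exact hO.irrefl _ (mem_of_mem_erase hy)
      refine delete_center h1 h2 ?_ ?_ h3 h4 ?_ hp ?_ ?_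
      · intro x hx; exact le_trans (card_le_card (h7 x hx)) (hsz x)
      · rw [h6]
        have := card_insert_le y (comp c p)
        have := hsz p
        omega
      · rw [Function.update_of_ne hwy, ← hpj, hcp]
      · intro l hl; rw [h5 l hl, hσ l hl.le]
      · rw [← hσ j le_rfl, one_lt_card]
        exact ⟨p, by rw [mem_comp, hpj], w j, by rw [mem_comp], hp⟩
    · exact swap_leaf hd hO hS hsz hD hL hcp hpj hy hyi hyU (Or.inl hp) hσ

def Sparse (G : SimpleGraph V) (k d : ℕ) : Prop :=
  ∀ (R : Finset V) (E : Finset (Σ _ : V, V)),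
    (∀ e ∈ E, e.1 ∈ R ∧ e.2 ∈ R ∧ G.Adj e.1 e.2 ∧ (⟨e.2, e.1⟩ : Σ _ : V, V) ∉ E) →
    (d + k + 1) * E.card ≤ (k * (d + k + 1) + d) * R.card

lemma Legal.inj {D : V → Finset V} {c a} {w : ℕ → V} {t} (h : Legal D c a w t) :
    Set.InjOn (fun i => c (w i)) (range t : Set ℕ) := by
  have key : ∀ l i, l < i → i < t → c (w l) ≠ c (w i) := fun l i hl hi e =>
    h.notInU hi ⟨l, hl, e.symm⟩
  intro i hi j hj e
  simp only [coe_range, Set.mem_Iio] at hi hj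
  rcases lt_trichotomy i j with h1 | h1 | h1
  · exact absurd e (key i j h1 hj)
  · exact h1
  · exact absurd e.symm (key j i h1 hi)

lemma Legal.le_card {D : V → Finset V} {c a} {w : ℕ → V} {t} (h : Legal D c a w t) :
    t ≤ Fintype.card V := by
  have := card_le_card_of_injOn (s := range t) (t := (univ : Finset V)) _ (fun _ _ => mem_univ _) h.inj
  simpa using this

/-- sizes along a legal sequence, as a lexicographic key -/
def key (n d : ℕ) (c : V → V) (w : ℕ → V) (t : ℕ) : Lex (Fin n → ℕ) :=
  toLex (fun i => if i.1 < t then (comp c (w i.1)).card else d + 2)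

/-- existence of an optimal state -/
lemma exists_optimal {G : SimpleGraph V} {k d : ℕ} {a : V}
    (h0 : ∃ D c, Ori G D ∧ StarS D c ∧ (∀ x, (comp c x).card ≤ d + 1) ∧ Deg k a D c) :
    ∃ D c w t, Ori G D ∧ StarS D c ∧ (∀ x, (comp c x).card ≤ d + 1) ∧ Deg k a D c ∧ 0 < t ∧
      Legal D c a w t ∧ (∀ j < t, ¬ Improves G k d a w (fun l => (comp c (w l)).card) j) ∧
      (∀ v, InU c w t v → ∀ u ∈ Bl D c v, InU c w t u) := by
  let n := Fintype.card V
  let S : Set (Lex (Fin n → ℕ)) := {κ | ∃ D c w t, Ori G D ∧ StarS D c ∧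
    (∀ x, (comp c x).card ≤ d + 1) ∧ Deg k a D c ∧ 0 < t ∧ Legal D c a w t ∧ κ = key n d c w t}
  have hS : S.Nonempty := by
    obtain ⟨D, c, h1, h2, h3, h4⟩ := h0
    exact ⟨_, D, c, fun _ => a, 1, h1, h2, h3, h4, one_pos, ⟨rfl, fun i hi h0 => by omega⟩, rfl⟩
  obtain ⟨κ, ⟨D, c, w, t, h1, h2, h3, h4, h5, h6, rfl⟩, hmin⟩ :=
    (wellFounded_lt (α := Lex (Fin n → ℕ))).has_min S hS
  refine ⟨D, c, w, t, h1, h2, h3, h4, h5, h6, ?_, ?_⟩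
  · rintro j hj ⟨D', c', g1, g2, g3, g4, g5, g6, g7⟩
    refine hmin (key n d c' w (j + 1)) ⟨D', c', w, j + 1, g1, g2, g3, g4, by omega, g5, rfl⟩ ?_
    have hjn : j < n := lt_of_lt_of_le hj h6.le_card
    refine ⟨⟨j, hjn⟩, ?_, ?_⟩
    · intro l hl
      have hl' : l.1 < j := hl
      show (if l.1 < j + 1 then _ else _) = (if l.1 < t then _ else _)
      rw [if_pos (by omega), if_pos (by omega), g6 _ hl']
    · show (if j < j + 1 then _ else _) < (if j < t then _ else _)
      rw [if_pos (by omega), if_pos (by omega)]; exact g7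
  · intro v hv u hu
    by_contra hnu
    have hww : ∀ l < t, Function.update w t u l = w l := fun l hl =>
      Function.update_of_ne (by omega) _ _
    have hUU : ∀ i ≤ t, ∀ q, InU c (Function.update w t u) i q ↔ InU c w i q := by
      intro i hi q
      constructor
      · rintro ⟨l, hl, e⟩; exact ⟨l, hl, by rw [e, hww l (by omega)]⟩
      · rintro ⟨l, hl, e⟩; exact ⟨l, hl, by rw [e, hww l (by omega)]⟩
    have hL : Legal D c a (Function.update w t u) (t + 1) := by
      refine ⟨by rw [hww 0 h5]; exact h6.1, fun i hi hi0 => ?_⟩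
      rcases Nat.lt_succ_iff_lt_or_eq.1 hi with h | rfl
      · simp only [hUU i h.le, hww i h]; exact h6.2 i h hi0
      · simp only [hUU i le_rfl, Function.update_self]
        exact ⟨hnu, v, hv, hu⟩
    refine hmin (key n d c (Function.update w t u) (t + 1))
      ⟨D, c, _, t + 1, h1, h2, h3, h4, by omega, hL, rfl⟩ ?_
    have htn : t < n := hL.le_card
    refine ⟨⟨t, htn⟩, ?_, ?_⟩
    · intro l hl
      have hl' : l.1 < t := hl
      show (if l.1 < t + 1 then _ else _) = (if l.1 < t then _ else _)
      rw [if_pos (by omega), if_pos (by omega), hww _ hl']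
    · show (if t < t + 1 then _ else _) < (if t < t then _ else _)
      rw [if_pos (by omega), if_neg (by omega)]
      exact Nat.lt_succ_of_le (h3 _)

lemma step {G : SimpleGraph V} {k d : ℕ} {a : V} (hd : 0 < d) (hdk : d ≤ k + 1)
    (hG : Sparse G k d)
    (h0 : ∃ D c, Ori G D ∧ StarS D c ∧ (∀ x, (comp c x).card ≤ d + 1) ∧ Deg k a D c) :
    Done G k d := by
  by_contra hnd
  obtain ⟨D, c, w, t, hO, hS, hsz, hD, ht, hL, hni, hcl⟩ := exists_optimal h0
  -- all reachable vertices are saturated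
  have hsat : ∀ v, InU c w t v → k + (if v = a then 1 else 0) ≤ (Bl D c v).card := by
    intro v hv
    by_contra hlt
    obtain ⟨j, hj, hvj⟩ := hv
    have hF : DegF k a v D c := by
      intro u
      have := hD u
      by_cases e : u = v
      · subst e; simp only [if_true]; omega
      · simp only [if_neg e]; omega
    by_cases e : v = w j
    · subst e
      rcases free_entry j hO hS hsz hF (hL.mono (by omega)) (fun l _ => rfl) with h | ⟨i, hi, h⟩
      · exact hnd h
      · exact hni i (by omega) h
    · exact hni j hj (delete hO hS hsz hF (hL.mono (by omega)) hvj e (fun l _ => rfl))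
  obtain ⟨s, hs⟩ : ∃ s : ℕ → ℕ, s = fun l => (comp c (w l)).card := ⟨_, rfl⟩
  have hs1 : ∀ i, 1 ≤ s i := by
    intro i; rw [hs]; exact card_pos.2 ⟨w i, by rw [mem_comp]⟩
  let I := (range t).filter (fun i => s i = 1)
  let J := (range t).filter (fun i => d + 1 ≤ s i)
  have hchild : ∀ i ∈ I, 0 < i → ∃ j ∈ J, w i ∈ Bl D c (w j) := by
    intro i hi h0
    obtain ⟨hi, hsi⟩ := mem_filter.1 hi
    rw [mem_range] at hi
    obtain ⟨hN, p, ⟨j, hj, hpj⟩, hm⟩ := hL.2 i hi h0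
    have hyi : ∀ u, c u = c (w i) → u = w i := by
      intro u hu
      rw [hs] at hsi
      obtain ⟨x, hx⟩ := card_eq_one.1 hsi
      have h1 : u ∈ comp c (w i) := by rw [mem_comp, hu]
      have h2 : w i ∈ comp c (w i) := by rw [mem_comp]
      rw [hx, mem_singleton] at h1 h2
      rw [h1, h2]
    rcases isolated_child hd hO hS hsz hD (hL.mono (by omega)) hpj hm hyi
      (fun h => hN (h.mono (by omega))) (σ := s) (fun l _ => by rw [hs]) with (h | ⟨l, hl, h⟩) | ⟨h1, h2⟩
    · exact absurd h hnd
    · rw [hs] at h; exact absurd h (hni l (by omega))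
    · exact ⟨j, mem_filter.2 ⟨mem_range.2 (by omega), h2⟩, h1 ▸ hm⟩
  have hwinj : Set.InjOn w (range t : Set ℕ) := by
    intro i hi j hj e
    exact hL.inj hi hj (by simp only [e])
  have hJdeg : ∀ j ∈ J, (Bl D c (w j)).card ≤ k + if j = 0 then 1 else 0 := by
    intro j hj
    have h1 := hD (w j)
    by_cases e : j = 0
    · subst e; rw [hL.1, if_pos rfl] at h1; rw [hL.1, if_pos rfl]; exact h1
    · rw [if_neg e]
      have : w j ≠ a := by
        rw [← hL.1]; intro e'
        exact e (hwinj (by simpa using (mem_range.1 (mem_filter.1 hj).1)) (by simpa using ht) e')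
      rwa [if_neg this] at h1
  have hsumJ : ∑ j ∈ J, (Bl D c (w j)).card ≤ k * J.card + if 0 ∈ J then 1 else 0 := by
    refine le_trans (sum_le_sum hJdeg) ?_
    rw [sum_add_distrib, sum_const, smul_eq_mul, sum_ite_eq', mul_comm]
  have hI : I.card ≤ 1 + k * J.card := by
    have hIc : I.card = (I.image w).card := by
      rw [card_image_of_injOn]
      exact hwinj.mono (by simp only [coe_subset]; exact filter_subset _ _)
    by_cases h0J : 0 ∈ J
    · have : I.image w ⊆ J.biUnion (fun j => Bl D c (w j)) := by
        intro x hx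
        obtain ⟨i, hi, rfl⟩ := mem_image.1 hx
        have : 0 < i := by
          rcases Nat.eq_zero_or_pos i with rfl | h
          · have h1 := (mem_filter.1 hi).2
            have h2 := (mem_filter.1 h0J).2
            omega
          · exact h
        obtain ⟨j, hj, hm⟩ := hchild i hi this
        exact mem_biUnion.2 ⟨j, hj, hm⟩
      have h1 := card_le_card this
      have h2 := card_biUnion_le (s := J) (t := fun j => Bl D c (w j))
      rw [if_pos h0J] at hsumJ
      omega
    · have : I.image w ⊆ insert a (J.biUnion (fun j => Bl D c (w j))) := by
        intro x hx
        obtain ⟨i, hi, rfl⟩ := mem_image.1 hx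
        rcases Nat.eq_zero_or_pos i with rfl | h
        · rw [hL.1]; exact mem_insert_self _ _
        · obtain ⟨j, hj, hm⟩ := hchild i hi h
          exact mem_insert_of_mem (mem_biUnion.2 ⟨j, hj, hm⟩)
      have h1 := card_le_card this
      have h2 := card_biUnion_le (s := J) (t := fun j => Bl D c (w j))
      have h3 := card_insert_le a (J.biUnion (fun j => Bl D c (w j)))
      rw [if_neg h0J] at hsumJ
      omega
  have hper : ∀ i ∈ range t, d + (k + 1) + d * k * (if d + 1 ≤ s i then 1 else 0) ≤
      (k + 1) * s i + d * (if s i = 1 then 1 else 0) := by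
    intro i _
    have := hs1 i
    by_cases e1 : s i = 1
    · rw [if_neg (by omega), if_pos e1, e1]; omega
    · rw [if_neg e1]
      by_cases e2 : d + 1 ≤ s i
      · rw [if_pos e2]; nlinarith
      · rw [if_neg e2]
        have : 2 ≤ s i := by omega
        nlinarith
  have hsum := sum_le_sum hper
  rw [sum_add_distrib, sum_add_distrib, sum_add_distrib, sum_add_distrib, sum_const, sum_const,
    sum_const, card_range, ← mul_sum,
    ← mul_sum, ← mul_sum, ← card_filter, ← card_filter, smul_eq_mul, smul_eq_mul, smul_eq_mul] at hsum
  change t * d + (t * k + t * 1) + d * k * J.card ≤ (k + 1) * ∑ i ∈ range t, s i + d * I.card at hsum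
  -- the closed set
  let R := (range t).biUnion (fun i => comp c (w i))
  have hR : ∀ v, v ∈ R ↔ InU c w t v := by
    intro v; simp only [R, mem_biUnion, mem_range, mem_comp, InU]
  have hRcard : R.card = ∑ i ∈ range t, s i := by
    rw [hs]
    refine card_biUnion ?_
    intro i hi j hj hij
    refine Finset.disjoint_left.2 ?_
    intro x hx hx'
    rw [mem_comp] at hx hx'
    exact hij (hL.inj (by simpa using hi) (by simpa using hj) (hx.symm.trans hx'))
  have hDcl : ∀ v ∈ R, ∀ u ∈ D v, u ∈ R := by
    intro v hv u hu
    rw [hR] at hv ⊢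
    by_cases e : u = c v
    · obtain ⟨l, hl, e'⟩ := hv
      exact ⟨l, hl, by rw [e, hS.idem, e']⟩
    · exact hcl v hv u (mem_erase.2 ⟨e, hu⟩)
  have hsp := hG R (R.sigma D) (by
    rintro ⟨u, v⟩ he
    rw [mem_sigma] at he
    obtain ⟨h1, h2⟩ := he
    refine ⟨h1, hDcl _ h1 _ h2, (hO.adj _ _).2 (Or.inl h2), ?_⟩
    intro h
    exact hO.asym _ _ h2 (mem_sigma.1 h).2)
  rw [card_sigma] at hsp
  have haR : a ∈ R := by rw [hR]; exact ⟨0, ht, by rw [hL.1]⟩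
  have hdeg : ∀ v ∈ R, k + 1 + (if v = a then 1 else 0) ≤ (D v).card + if c v = v then 1 else 0 := by
    intro v hv
    have h1 := hsat v ((hR v).1 hv)
    by_cases e : c v = v
    · rw [if_pos e]
      have := card_le_card (erase_subset (c v) (D v))
      simp only [Bl] at h1
      omega
    · rw [if_neg e]
      have h2 := card_erase_of_mem (hS.mem v e)
      have : 0 < (D v).card := card_pos.2 ⟨_, hS.mem v e⟩
      simp only [Bl] at h1
      omega
  have hsum2 := sum_le_sum hdeg
  rw [sum_add_distrib, sum_add_distrib, sum_add_distrib, sum_const, sum_const, sum_ite_eq',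
    if_pos haR, ← card_filter, smul_eq_mul, smul_eq_mul] at hsum2
  have hcent : (R.filter (fun v => c v = v)).card ≤ t := by
    have : R.filter (fun v => c v = v) ⊆ (range t).image (fun i => c (w i)) := by
      intro v hv
      obtain ⟨h1, h2⟩ := mem_filter.1 hv
      obtain ⟨l, hl, e⟩ := (hR v).1 h1
      exact mem_image.2 ⟨l, mem_range.2 hl, by rw [← e, h2]⟩
    exact le_trans (card_le_card this) (le_trans card_image_le (by simp))
  rw [← hRcard] at hsum
  have hB : R.card * (k + 1) + 1 ≤ (∑ v ∈ R, (D v).card) + t := by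
    rw [mul_add]; omega
  have hI' := Nat.mul_le_mul_left d hI
  have hB' := Nat.mul_le_mul_left (d + k + 1) hB
  nlinarith

lemma exists_good {k d : ℕ} (hd : 0 < d) (hdk : d ≤ k + 1) (G : SimpleGraph V) :
    Sparse G k d → Done G k d := by
  induction G using WellFoundedLT.induction with
  | _ G ih =>
  intro hG
  by_cases hE : ∃ a b, G.Adj a b
  · obtain ⟨a, b, hab⟩ := hE
    obtain ⟨G', hG'⟩ : ∃ G', G' = G.deleteEdges {s(a, b)} := ⟨_, rfl⟩
    have hadj : ∀ u v, G'.Adj u v ↔ G.Adj u v ∧ s(u, v) ≠ s(a, b) := by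
      intro u v; rw [hG', deleteEdges_adj]; simp
    have hle : G' ≤ G := fun u v h => ((hadj u v).1 h).1
    have hlt : G' < G := lt_of_le_of_ne hle (by
      intro e; rw [← e, hadj] at hab; exact hab.2 rfl)
    obtain ⟨D, c, h1, h2, h3, h4⟩ := ih G' hlt (fun R E hE => hG R E (fun e he =>
      ⟨(hE e he).1, (hE e he).2.1, hle (hE e he).2.2.1, (hE e he).2.2.2⟩))
    have hnab : ¬ G'.Adj a b := by rw [hadj]; simp
    have hb : b ∉ D a ∧ a ∉ D b := by rw [h1.adj] at hnab; tauto
    have hne : a ≠ b := hab.ne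
    have hmem : ∀ u v, v ∈ Function.update D a (insert b (D a)) u ↔ v ∈ D u ∨ (u = a ∧ v = b) := by
      intro u v
      by_cases e : u = a
      · subst e; simp [or_comm]
      · simp [Function.update_of_ne e, e]
    refine step (a := a) hd hdk hG ⟨Function.update D a (insert b (D a)), c, ⟨?_, ?_⟩, ⟨h2.idem, ?_⟩, h3, ?_⟩
    · intro u v
      rw [hmem, hmem]
      have := h1.adj u v
      rw [hadj, ne_eq, Sym2.eq_iff] at this
      have := hab.symm
      grind
    · intro u v
      rw [hmem, hmem]
      have := h1.asym u v
      grind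
    · intro v hv; rw [hmem]; exact Or.inl (h2.mem v hv)
    · intro u
      have := h4 u
      by_cases e : u = a
      · subst e
        simp only [Bl, Function.update_self, if_true] at this ⊢
        have h5 := card_le_card (show (insert b (D u)).erase (c u) ⊆ insert b ((D u).erase (c u)) by
          intro z; simp only [mem_erase, mem_insert]; tauto)
        have h6 := card_insert_le b ((D u).erase (c u))
        omega
      · simp only [Bl, Function.update_of_ne e] at this ⊢
        omega
  · push Not at hE
    refine ⟨fun _ => ∅, id, ⟨by simpa using hE, by simp⟩, ⟨by simp, by simp⟩, ?_, by simp [Bl]⟩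
    intro x
    have : comp id x = {x} := by ext u; simp [mem_comp]
    rw [this]; simp


lemma sparse_of_mad {k d : ℕ} {G : SimpleGraph V}
    (hmad : ∀ H : G.Subgraph, H.verts.Nonempty →
      (2 * H.edgeSet.ncard : ℝ) / H.verts.ncard ≤ 2 * ((k : ℝ) + d / (d + k + 1))) :
    Sparse G k d := by
  intro R E hE
  rcases R.eq_empty_or_nonempty with rfl | hR
  · have : E = ∅ := by
      apply eq_empty_of_forall_notMem
      intro e he; exact absurd (hE e he).1 (by simp)
    simp [this]
  have h := hmad ((⊤ : G.Subgraph).induce (R : Set V)) (by simpa using hR)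
  have hv : ((⊤ : G.Subgraph).induce (R : Set V)).verts.ncard = R.card := by
    simp [Set.ncard_coe_finset]
  have hc : E.card ≤ ((⊤ : G.Subgraph).induce (R : Set V)).edgeSet.ncard := by
    have hinj : Set.InjOn (fun e : (Σ _ : V, V) => s(e.1, e.2)) (E : Set (Σ _ : V, V)) := by
      rintro ⟨u, v⟩ h1 ⟨u', v'⟩ h2 e
      have h3 := (hE _ h1).2.2.2
      rw [Sym2.eq_iff] at e
      rcases e with ⟨e1, e2⟩ | ⟨e1, e2⟩
      · simp only at e1 e2; subst e1; subst e2; rfl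
      · simp only at e1 e2; subst e1; subst e2; exact absurd h2 h3
    rw [← Set.ncard_coe_finset E, ← Set.ncard_image_of_injOn hinj]
    apply Set.ncard_le_ncard _ (Set.toFinite _)
    rintro _ ⟨e, he, rfl⟩
    obtain ⟨h1, h2, h3, -⟩ := hE e he
    simp only [Subgraph.mem_edgeSet, Subgraph.induce_adj, Subgraph.top_adj]
    exact ⟨by simpa using h1, by simpa using h2, h3⟩
  rw [hv] at h
  have hRp : (0 : ℝ) < R.card := by exact_mod_cast hR.card_pos
  have hp : (0 : ℝ) < d + k + 1 := by positivity
  rw [div_le_iff₀ hRp] at h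
  have hc' : (E.card : ℝ) ≤ ((⊤ : G.Subgraph).induce (R : Set V)).edgeSet.ncard := by
    exact_mod_cast hc
  have h2 : (E.card : ℝ) ≤ ((k : ℝ) + d / (d + k + 1)) * R.card := by linarith
  have h3 := mul_le_mul_of_nonneg_left h2 hp.le
  have h4 : ((d : ℝ) + k + 1) * (((k : ℝ) + d / (d + k + 1)) * R.card) =
      (k * (d + k + 1) + d) * R.card := by
    field_simp
  rw [h4] at h3
  exact_mod_cast h3

/-- a graph whose edges have distinct tails is a pseudoforest -/
lemma pseudoforest_of_tail {P : Set (Sym2 V)} (τ : Sym2 V → V) (h1 : ∀ e ∈ P, τ e ∈ e)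
    (h2 : Set.InjOn τ P) : IsPseudoforest (SimpleGraph.fromEdgeSet P) := by
  intro c
  have hsub : compEdges (SimpleGraph.fromEdgeSet P) c ⊆ P := by
    rintro e ⟨he, -⟩
    rw [edgeSet_fromEdgeSet] at he
    exact he.1
  rw [← Set.ncard_image_of_injOn (h2.mono hsub)]
  apply Set.ncard_le_ncard _ (Set.toFinite _)
  rintro _ ⟨e, he, rfl⟩
  exact he.2 _ (h1 e (hsub he))

lemma decomp_of_done {G : SimpleGraph V} {k d : ℕ} (h : Done G k d) :
    ∃ P : Fin (k + 1) → Set (Sym2 V), IsPseudoforestDecomp G (k + 1) P ∧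
      ∃ i : Fin (k + 1),
        (SimpleGraph.fromEdgeSet (P i)).IsAcyclic ∧
        ∀ K : (SimpleGraph.fromEdgeSet (P i)).ConnectedComponent,
          (compEdges (SimpleGraph.fromEdgeSet (P i)) K).ncard ≤ d ∧
          ∃ v : V, ∀ e ∈ compEdges (SimpleGraph.fromEdgeSet (P i)) K, v ∈ e := by
  obtain ⟨D, c, hO, hS, hsz, hB⟩ := h
  have hf : ∀ u, Nonempty ({v // v ∈ Bl D c u} ↪ Fin k) := by
    intro u
    apply Function.Embedding.nonempty_of_card_le
    simpa using hB u
  let f := fun u => (hf u).some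
  let col : V → V → Fin (k + 1) := fun u v =>
    if h : v ∈ Bl D c u then (f u ⟨v, h⟩).castSucc else Fin.last k
  have hcl : ∀ u v, v ∈ D u → (col u v = Fin.last k ↔ v = c u) := by
    intro u v hv
    by_cases h : v ∈ Bl D c u
    · have : v ≠ c u := ne_of_mem_erase h
      simp only [col, dif_pos h, this, iff_false]
      exact Fin.castSucc_ne_last _
    · simp only [col, dif_neg h, true_iff]
      by_contra e; exact h (mem_erase.2 ⟨e, hv⟩)
  have hinj : ∀ u v v', v ∈ D u → v' ∈ D u → col u v = col u v' → v = v' := by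
    intro u v v' hv hv' e
    by_cases h : v = c u
    · have h1 := (hcl u v hv).2 h
      rw [e] at h1
      rw [h, (hcl u v' hv').1 h1]
    · by_cases h' : v' = c u
      · have h1 := (hcl u v' hv').2 h'
        rw [← e] at h1
        exact absurd ((hcl u v hv).1 h1) h
      · have m : v ∈ Bl D c u := mem_erase.2 ⟨h, hv⟩
        have m' : v' ∈ Bl D c u := mem_erase.2 ⟨h', hv'⟩
        simp only [col, dif_pos m, dif_pos m'] at e
        have := (f u).injective (Fin.castSucc_injective _ e)
        simpa using this
  have huniq : ∀ u v u' v', v ∈ D u → v' ∈ D u' → s(u, v) = s(u', v') → u = u' ∧ v = v' := by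
    intro u v u' v' h h' e
    rcases Sym2.eq_iff.1 e with e | ⟨rfl, rfl⟩
    · exact e
    · exact absurd h' (hO.asym _ _ h)
  let P : Fin (k + 1) → Set (Sym2 V) := fun i => {e | ∃ u v, v ∈ D u ∧ col u v = i ∧ e = s(u, v)}
  have hred : ∀ x y, (SimpleGraph.fromEdgeSet (P (Fin.last k))).Adj x y →
      x ≠ y ∧ (y = c x ∨ x = c y) := by
    intro x y h
    rw [fromEdgeSet_adj] at h
    obtain ⟨⟨u, v, hv, hc, e⟩, hne⟩ := h
    refine ⟨hne, ?_⟩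
    rw [hcl u v hv] at hc
    rcases Sym2.eq_iff.1 e with ⟨rfl, rfl⟩ | ⟨rfl, rfl⟩
    · exact Or.inl hc
    · exact Or.inr hc
  have hbr : ∀ x y, (SimpleGraph.fromEdgeSet (P (Fin.last k))).Adj x y → y = c x →
      ¬ ((SimpleGraph.fromEdgeSet (P (Fin.last k))) \ SimpleGraph.fromEdgeSet {s(x, y)}).Reachable x y := by
    intro x y hxy hy
    have hne := (hred x y hxy).1
    rintro ⟨W⟩
    cases W with
    | nil => exact hne rfl
    | cons hadj _ =>
      rename_i z _
      rw [sdiff_adj, fromEdgeSet_adj (s := {s(x, y)})] at hadj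
      obtain ⟨g1, g2⟩ := hadj
      obtain ⟨g3, g4⟩ := hred _ _ g1
      rcases g4 with g4 | g4
      · exact g2 ⟨by rw [g4, hy]; rfl, g3⟩
      · have := hS.idem z
        rw [← g4, ← hy] at this
        exact hne this.symm
  have hreach : ∀ x y, (SimpleGraph.fromEdgeSet (P (Fin.last k))).Reachable x y → c x = c y := by
    rintro x y ⟨W⟩
    induction W with
    | nil => rfl
    | cons hadj _ ih =>
      rw [← ih]
      rcases (hred _ _ hadj).2 with e | e
      · rw [e, hS.idem]
      · rw [e, hS.idem]
  refine ⟨P, ⟨?_, ?_, ?_, ?_⟩, Fin.last k, ?_, ?_⟩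
  · rintro i _ ⟨u, v, hv, -, rfl⟩
    exact (hO.adj u v).2 (Or.inl hv)
  · intro i j hij
    rw [Set.disjoint_left]
    rintro _ ⟨u, v, hv, hc, rfl⟩ ⟨u', v', hv', hc', e⟩
    obtain ⟨rfl, rfl⟩ := huniq _ _ _ _ hv hv' e
    exact hij (hc.symm.trans hc')
  · ext e
    induction e with
    | _ x y =>
    rw [Set.mem_iUnion, mem_edgeSet, hO.adj]
    constructor
    · rintro ⟨i, u, v, hv, -, e⟩
      rcases Sym2.eq_iff.1 e with ⟨rfl, rfl⟩ | ⟨rfl, rfl⟩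
      · exact Or.inl hv
      · exact Or.inr hv
    · rintro (h | h)
      · exact ⟨_, x, y, h, rfl, rfl⟩
      · exact ⟨_, y, x, h, rfl, Sym2.eq_swap⟩
  · intro i
    let τ : Sym2 V → V := fun e => if h : e ∈ P i then h.choose else e.out.1
    have hτ : ∀ e, e ∈ P i → ∃ v, v ∈ D (τ e) ∧ col (τ e) v = i ∧ e = s(τ e, v) := by
      intro e he
      simp only [τ, dif_pos he]
      exact he.choose_spec
    refine pseudoforest_of_tail τ ?_ ?_
    · intro e he
      obtain ⟨v, -, -, e1⟩ := hτ e he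
      have : τ e ∈ s(τ e, v) := Sym2.mem_mk_left _ _
      rwa [← e1] at this
    · intro e he e' he' heq
      obtain ⟨v, h1, h2, h3⟩ := hτ e he
      obtain ⟨v', h1', h2', h3'⟩ := hτ e' he'
      rw [← heq] at h1' h2' h3'
      rw [h3, h3', hinj _ _ _ h1 h1' (h2.trans h2'.symm)]
  · rw [isAcyclic_iff_forall_adj_isBridge]
    intro x y hxy
    rw [isBridge_iff]
    rcases (hred x y hxy).2 with e | e
    · exact hbr x y hxy e
    · intro h
      refine hbr y x hxy.symm e ?_
      rw [Sym2.eq_swap]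
      exact h.symm
  · intro K
    induction K using ConnectedComponent.ind with
    | _ x0 =>
    obtain ⟨z, hz⟩ : ∃ z, z = c x0 := ⟨_, rfl⟩
    have hcz : c z = z := by rw [hz, hS.idem]
    have hedge : ∀ e ∈ compEdges (SimpleGraph.fromEdgeSet (P (Fin.last k)))
        ((SimpleGraph.fromEdgeSet (P (Fin.last k))).connectedComponentMk x0),
        ∃ u, c u = z ∧ u ≠ z ∧ e = s(u, z) := by
      rintro e ⟨he, hall⟩
      rw [edgeSet_fromEdgeSet] at he
      obtain ⟨u, v, hv, hc, rfl⟩ := he.1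
      have h1 := hall u (Sym2.mem_mk_left _ _)
      rw [ConnectedComponent.mem_supp_iff, ConnectedComponent.eq] at h1
      have h2 := hreach _ _ h1
      rw [hcl u v hv] at hc
      refine ⟨u, by rw [h2, hz], ?_, by rw [hc, h2, hz]⟩
      rintro rfl
      rw [hc, hcz] at hv
      exact hO.irrefl _ hv
    refine ⟨?_, z, ?_⟩
    · have hsub : compEdges (SimpleGraph.fromEdgeSet (P (Fin.last k)))
        ((SimpleGraph.fromEdgeSet (P (Fin.last k))).connectedComponentMk x0) ⊆
          (((comp c z).erase z).image (fun u => s(u, z)) : Finset (Sym2 V)) := by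
        intro e he
        obtain ⟨u, h1, h2, rfl⟩ := hedge e he
        rw [mem_coe]
        exact mem_image.2 ⟨u, mem_erase.2 ⟨h2, by rw [mem_comp, h1, hcz]⟩, rfl⟩
      have h1 := Set.ncard_le_ncard hsub (Set.toFinite _)
      rw [Set.ncard_coe_finset] at h1
      have h2 := card_image_le (s := (comp c z).erase z) (f := fun u => s(u, z))
      rw [card_erase_of_mem (by rw [mem_comp])] at h2
      have := hsz z
      omega
    · intro e he
      obtain ⟨u, h1, h2, rfl⟩ := hedge e he
      exact Sym2.mem_mk_right _ _

end StarNDT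

theorem pseudoforest_sndt_star_forest
    (k d : ℕ) (hk : 0 < k) (hd : 0 < d) (hdk : d ≤ k + 1)
    (V : Type) [Fintype V] (G : SimpleGraph V)
    (hmad : ∀ H : G.Subgraph, H.verts.Nonempty →
      (2 * H.edgeSet.ncard : ℝ) / H.verts.ncard ≤ 2 * ((k : ℝ) + d / (d + k + 1))) :
    ∃ P : Fin (k + 1) → Set (Sym2 V), IsPseudoforestDecomp G (k + 1) P ∧
      ∃ i : Fin (k + 1),
        (SimpleGraph.fromEdgeSet (P i)).IsAcyclic ∧
        ∀ K : (SimpleGraph.fromEdgeSet (P i)).ConnectedComponent,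
          (compEdges (SimpleGraph.fromEdgeSet (P i)) K).ncard ≤ d ∧
          ∃ v : V, ∀ e ∈ compEdges (SimpleGraph.fromEdgeSet (P i)) K, v ∈ e := by
  classical
  exact StarNDT.decomp_of_done (StarNDT.exists_good hd hdk G (StarNDT.sparse_of_mad hmad))
end
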